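/- arXiv:1403.1324 — 9 statements merged into one kernel-verified Lean document; each statement's English description precedes it below -/
import Mathlib

section
/- Let k be an algebraically closed field of characteristic p > 0. Every finite subgroup of SL_2(k) of odd order not divisible by p is cyclic. -/
open Matrix

/-- `SL₂` over a commutative ring. -/
abbrev SL2 (k : Type*) [CommRing k] := Matrix.SpecialLinearGroup (Fin 2) k

open scoped commutatorElement

/-- A unimodular 2x2 matrix with an eigenvector satisfies the characteristic equation. -/
lemma aux_char {k : Type*} [Field k] (A : Matrix (Fin 2) (Fin 2) k) (hA : A.det = 1)
    (v : Fin 2 → k) (hv : v ≠ 0) (c : k) (h : A *ᵥ v = c • v) :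
    c ^ 2 - A.trace * c + 1 = 0 := by
  have h1 : (A - c • (1 : Matrix (Fin 2) (Fin 2) k)).det = 0 := by
    rw [← Matrix.exists_mulVec_eq_zero_iff]
    refine ⟨v, hv, ?_⟩
    rw [Matrix.sub_mulVec, h, Matrix.smul_mulVec, Matrix.one_mulVec, sub_self]
  rw [Matrix.det_fin_two] at h1 hA
  simp at h1
  rw [Matrix.trace_fin_two]
  linear_combination h1 - hA

/-- A unimodular matrix of finite order prime to the characteristic fixing a vector is trivial. -/
lemma aux_fix {k : Type*} [Field k] (A : Matrix (Fin 2) (Fin 2) k) (hA : A.det = 1)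
    (v : Fin 2 → k) (hv : v ≠ 0) (h : A *ᵥ v = v) (n : ℕ) (hn : (n : k) ≠ 0)
    (hAn : A ^ n = 1) : A = 1 := by
  have hc := aux_char A hA v hv 1 (by rw [h, one_smul])
  have h2 : (A - 1) * (A - 1) = 0 := by
    rw [Matrix.det_fin_two] at hA
    rw [Matrix.trace_fin_two] at hc
    ext i j
    fin_cases i <;> fin_cases j <;> simp [Matrix.mul_apply, Fin.sum_univ_two] <;> grind
  have h3 : ∀ m : ℕ, A ^ m = 1 + (m : k) • (A - 1) := by
    intro m
    induction m with
    | zero => simp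
    | succ m ih =>
      have e : A = 1 + (A - 1) := by abel
      rw [pow_succ, ih]
      calc (1 + (m : k) • (A - 1)) * A = (1 + (m : k) • (A - 1)) * (1 + (A - 1)) := by rw [← e]
        _ = 1 + (m : k) • (A - 1) + (A - 1) + (m : k) • ((A - 1) * (A - 1)) := by
          rw [mul_add, mul_one, add_mul, one_mul, smul_mul_assoc, add_assoc, add_assoc, add_assoc]
        _ = _ := by
          rw [h2]; push_cast; rw [add_smul, one_smul, smul_zero, add_zero, add_assoc]
  have h4 := h3 n
  rw [hAn] at h4
  have h5 : (n : k) • (A - 1) = 0 := by simpa using h4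
  rcases smul_eq_zero.1 h5 with h6 | h6
  · exact absurd h6 hn
  · exact sub_eq_zero.1 h6

/-- A nonscalar matrix has at most one-dimensional eigenspaces. -/
lemma aux_line {k : Type*} [Field k] (A : Matrix (Fin 2) (Fin 2) k)
    (v u : Fin 2 → k) (hv : v ≠ 0) (c : k) (h : A *ᵥ v = c • v) (hu : A *ᵥ u = c • u)
    (hns : A ≠ c • 1) : ∃ d : k, u = d • v := by
  have e0 := congrFun h 0
  have e1 := congrFun h 1
  have f0 := congrFun hu 0
  have f1 := congrFun hu 1
  simp [Matrix.mulVec, dotProduct, Fin.sum_univ_two] at e0 e1 f0 f1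
  have hD : v 0 * u 1 - v 1 * u 0 = 0 := by
    by_contra hD
    apply hns
    ext i j
    apply mul_right_cancel₀ hD
    fin_cases i <;> fin_cases j <;> simp [-mul_eq_mul_right_iff, -mul_eq_zero]
    · linear_combination u 1 * e0 - v 1 * f0
    · linear_combination v 0 * f0 - u 0 * e0
    · linear_combination u 1 * e1 - v 1 * f1
    · linear_combination v 0 * f1 - u 0 * e1
  by_cases h0 : v 0 = 0
  · have h1 : v 1 ≠ 0 := by
      intro h1; apply hv; ext i; fin_cases i <;> simp [h0, h1]
    refine ⟨u 1 / v 1, ?_⟩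
    ext i
    fin_cases i <;> simp <;> field_simp
    linear_combination -hD
  · refine ⟨u 0 / v 0, ?_⟩
    ext i
    fin_cases i <;> simp <;> field_simp
    linear_combination hD

lemma aux_eig {k : Type*} [Field k] [IsAlgClosed k] (A : Matrix (Fin 2) (Fin 2) k) :
    ∃ (v : Fin 2 → k) (c : k), v ≠ 0 ∧ A *ᵥ v = c • v := by
  obtain ⟨c, hc⟩ := Module.End.exists_eigenvalue (Matrix.toLin' A)
  obtain ⟨v, hv⟩ := hc.exists_hasEigenvector
  refine ⟨v, c, hv.2, ?_⟩
  simpa using hv.apply_eq_smul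

lemma aux_odd {Γ : Type*} [Group Γ] [Finite Γ] (hodd : Odd (Nat.card Γ)) (h : Γ) :
    ∃ m : ℕ, (h ^ 2) ^ m = h := by
  obtain ⟨m, hm⟩ := hodd
  refine ⟨m + 1, ?_⟩
  rw [← pow_mul, show 2 * (m + 1) = Nat.card Γ + 1 by omega, pow_succ, pow_card_eq_one', one_mul]

section
variable {k : Type*} [Field k] {Γ : Type*} [Group Γ] [Finite Γ]

lemma aux_fix_grp (f : Γ →* SL2 k) (hf : Function.Injective f)
    (hn : (Nat.card Γ : k) ≠ 0) (v : Fin 2 → k) (hv : v ≠ 0) (h : Γ)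
    (hh : (f h : Matrix (Fin 2) (Fin 2) k) *ᵥ v = v) : h = 1 := by
  apply hf
  rw [map_one]
  apply Subtype.ext
  refine aux_fix _ (f h).2 v hv hh _ hn ?_
  have : f h ^ Nat.card Γ = 1 := by rw [← map_pow, pow_card_eq_one', map_one]
  simpa using congrArg Subtype.val this

/-- A group with a common eigenvector is cyclic. -/
lemma aux_cyclic (f : Γ →* SL2 k) (hf : Function.Injective f)
    (hn : (Nat.card Γ : k) ≠ 0) (v : Fin 2 → k) (hv : v ≠ 0)
    (hh : ∀ h : Γ, ∃ c : k, (f h : Matrix (Fin 2) (Fin 2) k) *ᵥ v = c • v) : IsCyclic Γ := by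
  choose χ hχ using hh
  have inj : ∀ a b : k, a • v = b • v → a = b := fun a b => (smul_left_injective k hv).eq_iff.1
  let F : Γ →* k :=
    { toFun := χ
      map_one' := by
        apply inj
        rw [← hχ]; simp
      map_mul' := fun a b => by
        apply inj
        rw [← hχ, map_mul, Matrix.SpecialLinearGroup.coe_mul, ← Matrix.mulVec_mulVec, hχ b,
          Matrix.mulVec_smul, hχ a, smul_smul, mul_comm] }
  refine isCyclic_of_injective_ringHom F ((injective_iff_map_eq_one F).2 fun a ha => ?_)
  refine aux_fix_grp f hf hn v hv a ?_
  rw [hχ, show χ a = 1 from ha, one_smul]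

lemma aux_central [IsAlgClosed k] (f : Γ →* SL2 k) (hf : Function.Injective f)
    (hn : (Nat.card Γ : k) ≠ 0) (hodd : Odd (Nat.card Γ)) (g : Γ) (hg : g ≠ 1)
    (hc : ∀ h : Γ, h * g = g * h) : IsCyclic Γ := by
  obtain ⟨v, c, hv, hgv⟩ := aux_eig (f g : Matrix (Fin 2) (Fin 2) k)
  refine aux_cyclic f hf hn v hv fun h => ?_
  refine aux_line _ v _ hv c hgv ?_ ?_
  · rw [Matrix.mulVec_mulVec, ← Matrix.SpecialLinearGroup.coe_mul, ← map_mul, ← hc, map_mul,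
      Matrix.SpecialLinearGroup.coe_mul, ← Matrix.mulVec_mulVec, hgv, Matrix.mulVec_smul]
  · intro hs
    apply hg
    obtain ⟨m, hm⟩ := aux_odd hodd g
    have hd := (f g).2
    rw [hs, Matrix.det_fin_two] at hd
    simp at hd
    have : g ^ 2 = 1 := by
      refine aux_fix_grp f hf hn v hv _ ?_
      rw [map_pow, Matrix.SpecialLinearGroup.coe_pow, hs, smul_pow, one_pow, pow_two, hd, one_smul,
        Matrix.one_mulVec]
    rw [← hm, this, one_pow]

lemma aux_pow_eig (A : Matrix (Fin 2) (Fin 2) k) (v : Fin 2 → k) (c : k)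
    (h : A *ᵥ v = c • v) (n : ℕ) : (A ^ n) *ᵥ v = c ^ n • v := by
  induction n with
  | zero => simp
  | succ n ih => rw [pow_succ, ← Matrix.mulVec_mulVec, h, Matrix.mulVec_smul, ih, smul_smul,
      pow_succ, mul_comm]

lemma aux_norm [IsAlgClosed k] (f : Γ →* SL2 k) (hf : Function.Injective f)
    (hn : (Nat.card Γ : k) ≠ 0) (hodd : Odd (Nat.card Γ)) (g h : Γ) (n : ℕ)
    (hc : h * g * h⁻¹ = g ^ n) : h * g = g * h := by
  obtain ⟨v, c, hv, hgv⟩ := aux_eig (f g : Matrix (Fin 2) (Fin 2) k)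
  have hx : (f (g ^ n) : Matrix (Fin 2) (Fin 2) k) *ᵥ v = c ^ n • v := by
    rw [map_pow, Matrix.SpecialLinearGroup.coe_pow]
    exact aux_pow_eig _ _ _ hgv n
  have ht : (f (g ^ n) : Matrix (Fin 2) (Fin 2) k).trace
      = (f g : Matrix (Fin 2) (Fin 2) k).trace := by
    rw [← hc, map_mul, Matrix.SpecialLinearGroup.coe_mul, Matrix.trace_mul_comm,
      ← Matrix.SpecialLinearGroup.coe_mul, ← map_mul]
    congr 3
    group
  have c1 := aux_char _ (f g).2 v hv c hgv
  have c2 := aux_char _ (f (g ^ n)).2 v hv _ hx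
  rw [ht] at c2
  have hc0 : c ≠ 0 := by rintro rfl; simp at c1
  have hprod : (c ^ n - c) * (c ^ n * c - 1) = 0 := by
    linear_combination c * c2 - c ^ n * c1
  rcases mul_eq_zero.1 hprod with h1 | h1
  · have h1 := sub_eq_zero.1 h1
    have : g⁻¹ * g ^ n = 1 := by
      refine aux_fix_grp f hf hn v hv _ ?_
      rw [map_mul, Matrix.SpecialLinearGroup.coe_mul, ← Matrix.mulVec_mulVec, hx, h1, ← hgv,
        Matrix.mulVec_mulVec, ← Matrix.SpecialLinearGroup.coe_mul, ← map_mul]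
      simp
    have h3 : g = g ^ n := inv_mul_eq_one.1 this
    rw [← h3] at hc
    exact mul_inv_eq_iff_eq_mul.1 hc
  · have h1 := sub_eq_zero.1 h1
    have : g * g ^ n = 1 := by
      refine aux_fix_grp f hf hn v hv _ ?_
      rw [map_mul, Matrix.SpecialLinearGroup.coe_mul, ← Matrix.mulVec_mulVec, hx,
        Matrix.mulVec_smul, hgv, smul_smul, h1, one_smul]
    have h3 : g ^ n = g⁻¹ := (inv_eq_of_mul_eq_one_right this).symm
    rw [h3] at hc
    have hc1 : h * g = g⁻¹ * h := mul_inv_eq_iff_eq_mul.1 hc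
    have hc2 : h * g⁻¹ = g * h := by
      calc h * g⁻¹ = (h * g * h⁻¹)⁻¹ * h := by group
        _ = g * h := by rw [hc, inv_inv]
    have h2 : Commute (h ^ 2) g := by
      change h ^ 2 * g = g * h ^ 2
      rw [pow_two, mul_assoc, hc1, ← mul_assoc, hc2, mul_assoc]
    obtain ⟨m, hm⟩ := aux_odd hodd h
    have := h2.pow_left m
    rw [hm] at this
    exact this

end

/-- over an algebraically closed field of characteristic `p > 0`, every finite
subgroup of `SL₂(k)` of odd order not divisible by `p` is cyclic. -/
theorem odd_order_subgroup_SL2_isCyclic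
    (k : Type*) [Field k] [IsAlgClosed k] (p : ℕ) (hp : p.Prime) [CharP k p]
    (G : Subgroup (SL2 k)) [Finite G] (hodd : Odd (Nat.card G))
    (hord : ¬ p ∣ Nat.card G) :
    IsCyclic G := by
  have hf : Function.Injective G.subtype := G.subtype_injective
  have hn : (Nat.card G : k) ≠ 0 := by rwa [Ne, CharP.cast_eq_zero_iff k p]
  have hZ : IsZGroup G := by
    refine ⟨fun q hq P => ?_⟩
    have : Fact q.Prime := ⟨hq⟩
    rcases subsingleton_or_nontrivial P with hP | hP
    · infer_instance
    have := P.isPGroup'.center_nontrivial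
    obtain ⟨⟨g, hg⟩, hg1⟩ := exists_ne (1 : Subgroup.center P)
    have hdvd : Nat.card P ∣ Nat.card G := Subgroup.card_subgroup_dvd_card _
    refine aux_central (G.subtype.comp (P : Subgroup G).subtype)
      (hf.comp (Subgroup.subtype_injective _)) ?_ (hodd.of_dvd_nat hdvd) g ?_
      (Subgroup.mem_center_iff.1 hg)
    · rw [Ne, CharP.cast_eq_zero_iff k p]
      exact fun h => hord (h.trans hdvd)
    · rintro rfl
      exact hg1 rfl
  have key : ∀ g : G, g ≠ 1 → (∀ h : G, h * g * h⁻¹ ∈ Subgroup.zpowers g) → IsCyclic G := by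
    intro g hg hN
    refine aux_central G.subtype hf hn hodd g hg fun h => ?_
    obtain ⟨n, hn'⟩ := (mem_powers_iff_mem_zpowers).2 (hN h)
    exact aux_norm G.subtype hf hn hodd g h n hn'.symm
  obtain ⟨⟨g, hgm⟩, hg⟩ := (IsZGroup.isCyclic_commutator (G := G)).exists_generator
  by_cases hg1 : g = 1
  · subst hg1
    have hab : ∀ a b : G, a * b = b * a := by
      intro a b
      have hm : ⁅a, b⁆ ∈ commutator G :=
        Subgroup.commutator_mem_commutator (Subgroup.mem_top a) (Subgroup.mem_top b)
      obtain ⟨n, h⟩ := hg ⟨_, hm⟩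
      have h' := congrArg Subtype.val h
      simp at h'
      exact commutatorElement_eq_one_iff_mul_comm.1 h'.symm
    rcases subsingleton_or_nontrivial G with hs | hs
    · infer_instance
    obtain ⟨g, hg1⟩ := exists_ne (1 : G)
    refine key g hg1 fun h => ?_
    rw [hab h g, mul_inv_cancel_right]
    exact Subgroup.mem_zpowers g
  · refine key g hg1 fun h => ?_
    obtain ⟨n, hh⟩ := hg ⟨_, Subgroup.Normal.conj_mem inferInstance g hgm h⟩
    exact ⟨n, congrArg Subtype.val hh⟩
end

section
/- Let k be an algebraically closed field in which 24 is nonzero (i.e., char k = 0 or char k ≥ 5). Then the subgroup of SL_2(k) generated by diag(ζ_4, ζ_4^{-1}), the matrix [[0, ζ_4],[ζ_4, 0]], and s^{-1}·[[ζ_8^7, ζ_8^7],[ζ_8^5, ζ_8]], where s = ζ_8 + ζ_8^{-1} (so s² = 2), is a finite group of order 24 (the binary tetrahedral group). -/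
open Matrix

/-- The subgroup of `SL₂` generated by the elements whose underlying matrices lie in `S`. -/
def matGen {k : Type*} [CommRing k] (S : Set (Matrix (Fin 2) (Fin 2) k)) : Subgroup (SL2 k) :=
  Subgroup.closure {g : SL2 k | (g : Matrix (Fin 2) (Fin 2) k) ∈ S}

/-- Integer quaternions, as coordinate tuples. -/
abbrev IQ := ℤ × ℤ × ℤ × ℤ

/-- Quaternion multiplication. -/
def qmul (p q : IQ) : IQ :=
  (p.1 * q.1 - p.2.1 * q.2.1 - p.2.2.1 * q.2.2.1 - p.2.2.2 * q.2.2.2,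
   p.1 * q.2.1 + p.2.1 * q.1 + p.2.2.1 * q.2.2.2 - p.2.2.2 * q.2.2.1,
   p.1 * q.2.2.1 - p.2.1 * q.2.2.2 + p.2.2.1 * q.1 + p.2.2.2 * q.2.1,
   p.1 * q.2.2.2 + p.2.1 * q.2.2.1 - p.2.2.1 * q.2.1 + p.2.2.2 * q.1)

/-- Doubling. -/
def qdbl (p : IQ) : IQ := (2 * p.1, 2 * p.2.1, 2 * p.2.2.1, 2 * p.2.2.2)

/-- Halved product: the product of the halves, doubled. -/
def nm (p q : IQ) : IQ :=
  ((qmul p q).1 / 2, (qmul p q).2.1 / 2, (qmul p q).2.2.1 / 2, (qmul p q).2.2.2 / 2)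

/-- Conjugation. -/
def qconj (p : IQ) : IQ := (p.1, -p.2.1, -p.2.2.1, -p.2.2.2)

/-- Doubled Hurwitz units. -/
def HU : Finset IQ :=
  (({1, -1} : Finset ℤ) ×ˢ ({1, -1} : Finset ℤ) ×ˢ ({1, -1} : Finset ℤ) ×ˢ ({1, -1} : Finset ℤ)) ∪
  {(2, 0, 0, 0), (-2, 0, 0, 0), (0, 2, 0, 0), (0, -2, 0, 0),
   (0, 0, 2, 0), (0, 0, -2, 0), (0, 0, 0, 2), (0, 0, 0, -2)}

lemma HU_card : HU.card = 24 := by decide +kernel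

lemma HU_mul : ∀ p ∈ HU, ∀ q ∈ HU, nm p q ∈ HU ∧ qmul p q = qdbl (nm p q) := by
  decide +kernel

lemma HU_conj : ∀ p ∈ HU, qconj p ∈ HU := by decide +kernel

lemma HU_bound : ∀ p ∈ HU, (-2 ≤ p.1 ∧ p.1 ≤ 2) ∧ (-2 ≤ p.2.1 ∧ p.2.1 ≤ 2) ∧
    (-2 ≤ p.2.2.1 ∧ p.2.2.1 ≤ 2) ∧ (-2 ≤ p.2.2.2 ∧ p.2.2.2 ≤ 2) := by decide +kernel

lemma HU_gen : ∀ c ∈ ({(1, -1, 1, -1), (1, 1, 1, 1)} : Finset IQ), c ∈ HU ∧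
    ∀ p ∈ HU, ∃ x ∈ Finset.range 4, ∃ y ∈ Finset.range 2, ∃ z ∈ Finset.range 3,
    p = (nm (0, 2, 0, 0))^[x] ((nm (0, 0, 0, 2))^[y] ((nm c)^[z] (2, 0, 0, 0))) := by
  decide +kernel

/-- The matrix of a quaternion. -/
def qmat {k : Type*} [Field k] (i : k) (p : IQ) : Matrix (Fin 2) (Fin 2) k :=
  !![(p.1 : k) + p.2.1 * i, (p.2.2.1 : k) + p.2.2.2 * i;
     -(p.2.2.1 : k) + p.2.2.2 * i, (p.1 : k) - p.2.1 * i]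

lemma qmat_mul {k : Type*} [Field k] (i : k) (hi : i ^ 2 = -1) (p q : IQ) :
    qmat i p * qmat i q = qmat i (qmul p q) := by
  ext a b
  fin_cases a <;> fin_cases b <;> simp [qmat, qmul, Matrix.mul_apply, Fin.sum_univ_two] <;>
    grind

lemma qmat_dbl {k : Type*} [Field k] (i : k) (p : IQ) :
    qmat i (qdbl p) = (2 : k) • qmat i p := by
  ext a b
  fin_cases a <;> fin_cases b <;> simp [qmat, qdbl] <;> ring

lemma cast_small {k : Type*} [Field k] (hchar : (24 : k) ≠ 0) (n : ℤ) (h1 : -4 ≤ n) (h2 : n ≤ 4)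
    (h : (n : k) = 0) : n = 0 := by
  have h2' : (2 : k) ≠ 0 := fun h => hchar (by linear_combination 12 * h)
  have h3' : (3 : k) ≠ 0 := fun h => hchar (by linear_combination 8 * h)
  have h4' : (4 : k) ≠ 0 := fun h => hchar (by linear_combination 6 * h)
  interval_cases n <;> simp_all

lemma qmat_inj {k : Type*} [Field k] (hchar : (24 : k) ≠ 0) (i : k) (hi : i ^ 2 = -1)
    (p q : IQ) (hp : p ∈ HU) (hq : q ∈ HU) (h : qmat i p = qmat i q) : p = q := by
  have h2' : (2 : k) ≠ 0 := fun h => hchar (by linear_combination 12 * h)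
  have e1 := congrFun (congrFun h 0) 0
  have e2 := congrFun (congrFun h 0) 1
  have e3 := congrFun (congrFun h 1) 0
  have e4 := congrFun (congrFun h 1) 1
  have bp := HU_bound p hp
  have bq := HU_bound q hq
  obtain ⟨a, b, c, d⟩ := p
  obtain ⟨a', b', c', d'⟩ := q
  simp only [qmat, Matrix.of_apply, Matrix.cons_val', Matrix.cons_val_zero, Matrix.cons_val_one,
    Matrix.cons_val_fin_one] at e1 e2 e3 e4
  simp only at bp bq
  have ha : a - a' = 0 := cast_small hchar _ (by omega) (by omega) (by
    apply mul_left_cancel₀ h2'; push_cast; linear_combination e1 + e4)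
  have hb : b - b' = 0 := cast_small hchar _ (by omega) (by omega) (by
    apply mul_left_cancel₀ h2'; push_cast
    linear_combination -i * (e1 - e4) + 2 * ((b : k) - b') * hi)
  have hc : c - c' = 0 := cast_small hchar _ (by omega) (by omega) (by
    apply mul_left_cancel₀ h2'; push_cast; linear_combination e2 - e3)
  have hd : d - d' = 0 := cast_small hchar _ (by omega) (by omega) (by
    apply mul_left_cancel₀ h2'; push_cast
    linear_combination -i * (e2 + e3) + 2 * ((d : k) - d') * hi)
  simp only [Prod.mk.injEq]
  omega

lemma rel_mul {k : Type*} [Field k] (hchar : (24 : k) ≠ 0) (i : k) (hi : i ^ 2 = -1)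
    (p q : IQ) (hp : p ∈ HU) (hq : q ∈ HU) (g h : SL2 k)
    (hg : (2 : k) • (g : Matrix (Fin 2) (Fin 2) k) = qmat i p)
    (hh : (2 : k) • (h : Matrix (Fin 2) (Fin 2) k) = qmat i q) :
    (2 : k) • ((g * h : SL2 k) : Matrix (Fin 2) (Fin 2) k) = qmat i (nm p q) := by
  have h2' : (2 : k) ≠ 0 := fun h => hchar (by linear_combination 12 * h)
  have := qmat_mul i hi p q
  rw [(HU_mul p hp q hq).2, qmat_dbl, ← hg, ← hh, Matrix.smul_mul, Matrix.mul_smul] at this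
  rw [Matrix.SpecialLinearGroup.coe_mul]
  exact smul_right_injective _ h2' this

lemma card_aux {k : Type*} [Field k] (hchar : (24 : k) ≠ 0) (i : k) (hi : i ^ 2 = -1)
    (c : IQ) (hc : c ∈ ({(1, -1, 1, -1), (1, 1, 1, 1)} : Finset IQ))
    (S : Set (Matrix (Fin 2) (Fin 2) k))
    (hS : S = {(2 : k)⁻¹ • qmat i (0, 2, 0, 0), (2 : k)⁻¹ • qmat i (0, 0, 0, 2),
      (2 : k)⁻¹ • qmat i c}) :
    Finite (matGen S) ∧ Nat.card (matGen S) = 24 := by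
  have h2' : (2 : k) ≠ 0 := fun h => hchar (by linear_combination 12 * h)
  obtain ⟨hcH, hgen⟩ := HU_gen c hc
  have key : ∀ g ∈ matGen S, ∃ q ∈ HU, (2 : k) • (g : Matrix (Fin 2) (Fin 2) k) = qmat i q := by
    intro g hg
    induction hg using Subgroup.closure_induction with
    | mem x hx =>
      have hx' : (x : Matrix (Fin 2) (Fin 2) k) ∈ S := hx
      rw [hS] at hx'
      rcases hx' with h | h | h
      · exact ⟨(0, 2, 0, 0), by decide +kernel, by rw [h, smul_inv_smul₀ h2']⟩
      · exact ⟨(0, 0, 0, 2), by decide +kernel, by rw [h, smul_inv_smul₀ h2']⟩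
      · exact ⟨_, hcH, by rw [h, smul_inv_smul₀ h2']⟩
    | one =>
      refine ⟨(2, 0, 0, 0), by decide +kernel, ?_⟩
      ext a b
      fin_cases a <;> fin_cases b <;> simp [qmat]
    | mul x y _ _ hx hy =>
      obtain ⟨p, hp, ep⟩ := hx
      obtain ⟨q, hq, eq⟩ := hy
      exact ⟨_, (HU_mul p hp q hq).1, rel_mul hchar i hi p q hp hq x y ep eq⟩
    | inv x _ hx =>
      obtain ⟨p, hp, ep⟩ := hx
      refine ⟨_, HU_conj p hp, ?_⟩
      have e1 := congrFun (congrFun ep 0) 0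
      have e2 := congrFun (congrFun ep 0) 1
      have e3 := congrFun (congrFun ep 1) 0
      have e4 := congrFun (congrFun ep 1) 1
      rw [Matrix.SpecialLinearGroup.coe_inv, Matrix.adjugate_fin_two]
      ext a b
      fin_cases a <;> fin_cases b <;> simp [qmat, qconj] at e1 e2 e3 e4 ⊢ <;> grind
  have step : ∀ p ∈ HU, (p = (0, 2, 0, 0) ∨ p = (0, 0, 0, 2) ∨ p = c) →
      (∃ g ∈ matGen S, (2 : k) • (g : Matrix (Fin 2) (Fin 2) k) = qmat i p) := by
    intro p hp hpc
    have hdet : ∀ q ∈ ({(1, -1, 1, -1), (1, 1, 1, 1), (0, 2, 0, 0), (0, 0, 0, 2)} : Finset IQ),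
        ((2 : k)⁻¹ • qmat i q).det = 1 := by
      intro q hq
      simp only [Finset.mem_insert, Finset.mem_singleton] at hq
      rcases hq with rfl | rfl | rfl | rfl <;> simp [qmat, Matrix.det_fin_two] <;> field_simp <;>
        grind
    have hm : p ∈ ({(1, -1, 1, -1), (1, 1, 1, 1), (0, 2, 0, 0), (0, 0, 0, 2)} : Finset IQ) := by
      simp only [Finset.mem_insert, Finset.mem_singleton] at hc ⊢
      rcases hpc with h | h | h <;> subst h <;> tauto
    refine ⟨⟨(2 : k)⁻¹ • qmat i p, hdet p hm⟩, Subgroup.subset_closure ?_, ?_⟩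
    · change (2 : k)⁻¹ • qmat i p ∈ S
      rw [hS]
      rcases hpc with h | h | h <;> subst h <;> simp
    · exact smul_inv_smul₀ h2' _
  let T : IQ → Prop := fun q => q ∈ HU ∧
    ∃ g ∈ matGen S, (2 : k) • (g : Matrix (Fin 2) (Fin 2) k) = qmat i q
  have Tmul : ∀ p q, T p → T q → T (nm p q) := by
    rintro p q ⟨hp, g, hg, eg⟩ ⟨hq, h, hh, eh⟩
    exact ⟨(HU_mul p hp q hq).1, g * h, mul_mem hg hh, rel_mul hchar i hi p q hp hq g h eg eh⟩
  have Titer : ∀ p, T p → ∀ n q, T q → T ((nm p)^[n] q) := by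
    intro p hp n
    induction n with
    | zero => intro q hq; exact hq
    | succ n ih => intro q hq; exact ih _ (Tmul _ _ hp hq)
  have T1 : T (2, 0, 0, 0) := by
    refine ⟨by decide +kernel, 1, one_mem _, ?_⟩
    ext a b
    fin_cases a <;> fin_cases b <;> simp [qmat]
  have TI : T (0, 2, 0, 0) := ⟨by decide +kernel, step _ (by decide +kernel) (by simp)⟩
  have TK : T (0, 0, 0, 2) := ⟨by decide +kernel, step _ (by decide +kernel) (by simp)⟩
  have TC : T c := ⟨hcH, step _ hcH (by simp)⟩
  have Tall : ∀ p ∈ HU, ∃ g ∈ matGen S, (2 : k) • (g : Matrix (Fin 2) (Fin 2) k) = qmat i p := by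
    intro p hp
    obtain ⟨x, _, y, _, z, _, e⟩ := hgen p hp
    rw [e]
    exact (Titer _ TI x _ (Titer _ TK y _ (Titer _ TC z _ T1))).2
  choose f hf hf2 using Tall
  let φ : HU → matGen S := fun p => ⟨f p.1 p.2, hf p.1 p.2⟩
  have hφ : Function.Bijective φ := by
    constructor
    · rintro ⟨p, hp⟩ ⟨q, hq⟩ h
      have h' : f p hp = f q hq := congrArg Subtype.val h
      apply Subtype.ext
      apply qmat_inj hchar i hi p q hp hq
      rw [← hf2 p hp, ← hf2 q hq, h']
    · rintro ⟨g, hg⟩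
      obtain ⟨q, hq, e⟩ := key g hg
      refine ⟨⟨q, hq⟩, Subtype.ext (Subtype.ext ?_)⟩
      apply smul_right_injective _ h2'
      change (2 : k) • (f q hq : Matrix (Fin 2) (Fin 2) k) = (2 : k) • (g : Matrix (Fin 2) (Fin 2) k)
      rw [hf2, e]
  refine ⟨Finite.of_surjective φ hφ.2, ?_⟩
  rw [← Nat.card_eq_of_bijective φ hφ]
  simp [HU_card]

/-- over an algebraically closed field in which `24` is nonzero, the binary
tetrahedral group, i.e. the subgroup of `SL₂(k)` generated by `diag(ζ₄, ζ₄⁻¹)`,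
`[[0, ζ₄], [ζ₄, 0]]` and `s⁻¹ • [[ζ₈⁷, ζ₈⁷], [ζ₈⁵, ζ₈]]` with `s = ζ₈ + ζ₈⁻¹`,
is a finite group of order `24`. -/
theorem binary_tetrahedral_card (k : Type*) [Field k] [IsAlgClosed k]
    (hchar : (24 : k) ≠ 0)
    (ζ₄ : k) (hζ₄ : IsPrimitiveRoot ζ₄ 4)
    (ζ₈ : k) (hζ₈ : IsPrimitiveRoot ζ₈ 8) :
    letI G : Subgroup (SL2 k) := matGen
      {!![ζ₄, 0; 0, ζ₄⁻¹], !![0, ζ₄; ζ₄, 0],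
        (ζ₈ + ζ₈⁻¹)⁻¹ • !![ζ₈ ^ 7, ζ₈ ^ 7; ζ₈ ^ 5, ζ₈]}
    Finite G ∧ Nat.card G = 24 := by
  have h2' : (2 : k) ≠ 0 := fun h => hchar (by linear_combination 12 * h)
  have hi : ζ₄ ^ 2 = -1 := by
    have h1 := hζ₄.pow_eq_one
    have h2 := hζ₄.pow_ne_one_of_pos_of_lt (l := 2) (by norm_num) (by norm_num)
    have : (ζ₄ ^ 2 - 1) * (ζ₄ ^ 2 + 1) = 0 := by linear_combination h1
    rcases mul_eq_zero.1 this with h | h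
    · exact absurd (sub_eq_zero.1 h) h2
    · linear_combination h
  have he : ζ₈ ^ 4 = -1 := by
    have h1 := hζ₈.pow_eq_one
    have h2 := hζ₈.pow_ne_one_of_pos_of_lt (l := 4) (by norm_num) (by norm_num)
    have : (ζ₈ ^ 4 - 1) * (ζ₈ ^ 4 + 1) = 0 := by linear_combination h1
    rcases mul_eq_zero.1 this with h | h
    · exact absurd (sub_eq_zero.1 h) h2
    · linear_combination h
  have hinv4 : ζ₄⁻¹ = -ζ₄ := inv_eq_of_mul_eq_one_right (by linear_combination -hi)
  have hinv8 : ζ₈⁻¹ = -ζ₈ ^ 3 := inv_eq_of_mul_eq_one_right (by linear_combination -he)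
  have hs : (ζ₈ + ζ₈⁻¹)⁻¹ = 2⁻¹ * (ζ₈ - ζ₈ ^ 3) := by
    rw [hinv8]
    apply inv_eq_of_mul_eq_one_right
    field_simp
    linear_combination (-2 + ζ₈ ^ 2) * he
  have hI : !![ζ₄, 0; 0, ζ₄⁻¹] = (2 : k)⁻¹ • qmat ζ₄ (0, 2, 0, 0) := by
    rw [hinv4]
    ext a b
    fin_cases a <;> fin_cases b <;> simp [qmat, h2']
  have hK : !![0, ζ₄; ζ₄, 0] = (2 : k)⁻¹ • qmat ζ₄ (0, 0, 0, 2) := by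
    ext a b
    fin_cases a <;> fin_cases b <;> simp [qmat, h2']
  have hcase : ζ₈ ^ 2 = ζ₄ ∨ ζ₈ ^ 2 = -ζ₄ := by
    apply sq_eq_sq_iff_eq_or_eq_neg.1
    linear_combination he - hi
  rw [hI, hK, hs]
  rcases hcase with h | h
  · apply card_aux hchar ζ₄ hi (1, -1, 1, -1) (by simp)
    congr 3
    rw [mul_smul]
    congr 1
    ext a b
    fin_cases a <;> fin_cases b <;> simp [qmat] <;> grind
  · apply card_aux hchar ζ₄ hi (1, 1, 1, 1) (by simp)
    congr 3
    rw [mul_smul]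
    congr 1
    ext a b
    fin_cases a <;> fin_cases b <;> simp [qmat] <;> grind
end

section
/- Let k be an algebraically closed field in which 48 is nonzero (i.e., char k = 0 or char k ≥ 5). Then the subgroup of SL_2(k) generated by diag(ζ_8, ζ_8^{-1}), the matrix [[0, ζ_4],[ζ_4, 0]], and s^{-1}·[[ζ_8^7, ζ_8^7],[ζ_8^5, ζ_8]], where s = ζ_8 + ζ_8^{-1} (so s² = 2), is a finite group of order 48 (the binary octahedral group). -/
open Matrix

section abstractGroup
variable {G : Type*} [Group G]

/-- The candidate set of elements `t ^ m * w ^ j * a ^ i`. -/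
def octSet (a w t : G) : Set G :=
  {g | ∃ m < 3, ∃ j < 2, ∃ i < 8, g = t ^ m * (w ^ j * a ^ i)}

lemma a_pow_mul_w {a w : G} (hwa : a * w = w * a ^ 7) (i : ℕ) :
    a ^ i * w = w * a ^ (7 * i) := by
  induction i with
  | zero => simp
  | succ n ih =>
    rw [pow_succ, mul_assoc, hwa, ← mul_assoc, ih, mul_assoc, ← pow_add]
    ring_nf

lemma mem_D {a w : G} (h8 : a ^ 8 = 1) (hw : w ^ 2 = a ^ 4)
    (j i : ℕ) : ∃ j' < 2, ∃ i' < 8, w ^ j * a ^ i = w ^ j' * a ^ i' := by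
  refine ⟨j % 2, Nat.mod_lt _ (by norm_num), (4 * (j / 2) + i) % 8, Nat.mod_lt _ (by norm_num), ?_⟩
  have e1 : a ^ ((4 * (j / 2) + i) % 8) = a ^ (4 * (j / 2) + i) := by
    conv_rhs => rw [← Nat.mod_add_div (4 * (j / 2) + i) 8, pow_add, pow_mul, h8, one_pow, mul_one]
  rw [e1, pow_add, pow_mul a 4, ← hw, ← pow_mul, ← mul_assoc, ← pow_add, Nat.mod_add_div]

lemma D_mul {a w : G} (h8 : a ^ 8 = 1) (hw : w ^ 2 = a ^ 4) (hwa : a * w = w * a ^ 7)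
    (j i j' i' : ℕ) (hj' : j' < 2) :
    ∃ J < 2, ∃ I < 8, (w ^ j * a ^ i) * (w ^ j' * a ^ i') = w ^ J * a ^ I := by
  interval_cases j'
  · obtain ⟨J, hJ, I, hI, h⟩ := mem_D h8 hw j (i + i')
    refine ⟨J, hJ, I, hI, ?_⟩
    rw [← h, pow_add]; group
  · obtain ⟨J, hJ, I, hI, h⟩ := mem_D h8 hw (j + 1) (7 * i + i')
    refine ⟨J, hJ, I, hI, ?_⟩
    rw [← h, pow_add a, pow_succ w j, pow_one, mul_assoc, ← mul_assoc (a ^ i), a_pow_mul_w hwa]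
    simp only [mul_assoc]

lemma octSet_step {a w t : G} (h8 : a ^ 8 = 1) (hw : w ^ 2 = a ^ 4) (hwa : a * w = w * a ^ 7)
    (g : G) (hg : ∀ m < 3, g * t ^ m ∈ octSet a w t) {x : G} (hx : x ∈ octSet a w t) :
    g * x ∈ octSet a w t := by
  obtain ⟨m, hm, j, hj, i, hi, rfl⟩ := hx
  obtain ⟨m', hm', j', hj', i', hi', h⟩ := hg m hm
  obtain ⟨J, hJ, I, hI, h2⟩ := D_mul h8 hw hwa j' i' j i hj
  exact ⟨m', hm', J, hJ, I, hI, by rw [← mul_assoc, h, mul_assoc, h2]⟩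

lemma octSet_eq {a w t : G} (h8 : a ^ 8 = 1) (hw : w ^ 2 = a ^ 4) (hwa : a * w = w * a ^ 7)
    (ht : t ^ 3 = a ^ 4) (hat : ∃ i < 8, a * t = t ^ 2 * (w ^ 1 * a ^ i))
    (hat2 : a * t ^ 2 = t * a ^ 7) (hwt : w * t = t * (w * a ^ 6))
    (hwt2 : ∃ i < 8, w * t ^ 2 = t ^ 2 * a ^ i) :
    (Subgroup.closure {a, w, t} : Set G) = octSet a w t := by
  have ha : ∀ m < 3, a * t ^ m ∈ octSet a w t := by
    intro m hm
    interval_cases m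
    · exact ⟨0, by norm_num, 0, by norm_num, 1, by norm_num, by simp⟩
    · obtain ⟨i, hi, h⟩ := hat
      exact ⟨2, by norm_num, 1, by norm_num, i, hi, by rw [← h]; simp⟩
    · exact ⟨1, by norm_num, 0, by norm_num, 7, by norm_num, by rw [hat2]; simp⟩
  have hw' : ∀ m < 3, w * t ^ m ∈ octSet a w t := by
    intro m hm
    interval_cases m
    · exact ⟨0, by norm_num, 1, by norm_num, 0, by norm_num, by simp⟩
    · exact ⟨1, by norm_num, 1, by norm_num, 6, by norm_num, by simp [hwt]⟩
    · obtain ⟨i, hi, h⟩ := hwt2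
      exact ⟨2, by norm_num, 0, by norm_num, i, hi, by rw [h]; simp⟩
  have ht' : ∀ m < 3, t * t ^ m ∈ octSet a w t := by
    intro m hm
    interval_cases m
    · exact ⟨1, by norm_num, 0, by norm_num, 0, by norm_num, by simp⟩
    · exact ⟨2, by norm_num, 0, by norm_num, 0, by norm_num, by simp [pow_two]⟩
    · exact ⟨0, by norm_num, 0, by norm_num, 4, by norm_num, by rw [← pow_succ', ht]; simp⟩
  have hs : ∀ g ∈ ({a, w, t} : Set G), ∀ x ∈ octSet a w t, g * x ∈ octSet a w t := by
    rintro g (rfl | rfl | rfl) x hx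
    · exact octSet_step h8 hw hwa _ ha hx
    · exact octSet_step h8 hw hwa _ hw' hx
    · exact octSet_step h8 hw hwa _ ht' hx
  have hp : ∀ g ∈ ({a, w, t} : Set G), ∀ n : ℕ, ∀ x ∈ octSet a w t, g ^ n * x ∈ octSet a w t := by
    intro g hg n
    induction n with
    | zero => intro x hx; simpa using hx
    | succ n ih => intro x hx; rw [pow_succ, mul_assoc]; exact ih _ (hs g hg x hx)
  have h24 : ∀ g ∈ ({a, w, t} : Set G), g ^ 24 = 1 := by
    have h1 : a ^ 24 = 1 := by rw [show 24 = 8 * 3 by norm_num, pow_mul, h8, one_pow]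
    rintro g (rfl | rfl | rfl)
    · exact h1
    · rw [show 24 = 2 * 12 by norm_num, pow_mul, hw, ← pow_mul,
        show 4 * 12 = 24 * 2 by norm_num, pow_mul, h1, one_pow]
    · rw [show 24 = 3 * 8 by norm_num, pow_mul, ht, ← pow_mul,
        show 4 * 8 = 8 * 4 by norm_num, pow_mul, h8, one_pow]
  apply Set.Subset.antisymm
  · intro x hx
    induction hx using Subgroup.closure_induction_left with
    | one => exact ⟨0, by norm_num, 0, by norm_num, 0, by norm_num, by simp⟩
    | mul_left g hg y hy ih => exact hs g hg y ih
    | inv_mul_cancel g hg y hy ih =>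
      have : g⁻¹ = g ^ 23 := by
        rw [inv_eq_iff_mul_eq_one, ← pow_succ', h24 g hg]
      rw [this]; exact hp g hg 23 y ih
  · rintro x ⟨m, hm, j, hj, i, hi, rfl⟩
    have h1 : a ∈ Subgroup.closure ({a, w, t} : Set G) := Subgroup.subset_closure (by simp)
    have h2 : w ∈ Subgroup.closure ({a, w, t} : Set G) := Subgroup.subset_closure (by simp)
    have h3 : t ∈ Subgroup.closure ({a, w, t} : Set G) := Subgroup.subset_closure (by simp)
    exact mul_mem (pow_mem h3 _) (mul_mem (pow_mem h2 _) (pow_mem h1 _))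

lemma octSet_card {a w t : G} (hinj : ∀ m < 3, ∀ j < 2, ∀ i < 8, ∀ m' < 3, ∀ j' < 2, ∀ i' < 8,
    t ^ m * (w ^ j * a ^ i) = t ^ m' * (w ^ j' * a ^ i') → m = m' ∧ j = j' ∧ i = i') :
    Finite (octSet a w t) ∧ Nat.card (octSet a w t) = 48 := by
  let f : Fin 3 × Fin 2 × Fin 8 → G := fun p => t ^ p.1.1 * (w ^ p.2.1.1 * a ^ p.2.2.1)
  have hf : Function.Injective f := by
    rintro ⟨m, j, i⟩ ⟨m', j', i'⟩ h
    obtain ⟨h1, h2, h3⟩ := hinj m m.2 j j.2 i i.2 m' m'.2 j' j'.2 i' i'.2 h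
    simp [Fin.ext_iff, h1, h2, h3]
  have hr : octSet a w t = Set.range f := by
    ext x
    constructor
    · rintro ⟨m, hm, j, hj, i, hi, rfl⟩
      exact ⟨⟨⟨m, hm⟩, ⟨j, hj⟩, ⟨i, hi⟩⟩, rfl⟩
    · rintro ⟨⟨m, j, i⟩, rfl⟩
      exact ⟨m, m.2, j, j.2, i, i.2, rfl⟩
  rw [hr]
  refine ⟨Set.finite_range f, ?_⟩
  rw [Nat.card_range_of_injective hf]
  simp

end abstractGroup

section concrete
variable {k : Type*} [Field k]

/-- The underlying matrix. -/
def mv (g : SL2 k) : Matrix (Fin 2) (Fin 2) k := (g : Matrix (Fin 2) (Fin 2) k)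

lemma mv_mul (g h : SL2 k) : mv (g * h) = mv g * mv h := Matrix.SpecialLinearGroup.coe_mul g h

lemma mv_one : mv (1 : SL2 k) = 1 := Matrix.SpecialLinearGroup.coe_one

lemma mv_pow (g : SL2 k) (n : ℕ) : mv (g ^ n) = mv g ^ n := Matrix.SpecialLinearGroup.coe_pow g n

lemma mv_ext {g h : SL2 k} (e : mv g = mv h) : g = h := Subtype.ext e

lemma diag_pow (z y : k) (n : ℕ) :
    (!![z, 0; 0, y] : Matrix (Fin 2) (Fin 2) k) ^ n = !![z ^ n, 0; 0, y ^ n] := by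
  induction n with
  | zero => ext i j; fin_cases i <;> fin_cases j <;> simp
  | succ n ih => rw [pow_succ, ih]; simp [pow_succ]

lemma oct_core (z h v : k) (hz : z ^ 4 = -1) (hh : 2 * h = 1) (hz8 : IsPrimitiveRoot z 8)
    (hv : v = z ^ 2 ∨ v = - z ^ 2) (a w t : SL2 k)
    (ha : (mv a) = !![z, 0; 0, -z ^ 3]) (hw : (mv w) = !![0, v; v, 0])
    (ht : (mv t) = !![h * (1 - z ^ 2), h * (1 - z ^ 2); h * (-1 - z ^ 2), h * (1 + z ^ 2)]) :
    Finite (Subgroup.closure {a, w, t}) ∧ Nat.card (Subgroup.closure {a, w, t}) = 48 := by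
  have hz0 : z ≠ 0 := by rintro rfl; norm_num at hz
  have hh0 : h ≠ 0 := by rintro rfl; norm_num at hh
  have h20 : (2 : k) ≠ 0 := by rintro h2; rw [h2] at hh; norm_num at hh
  have apow : ∀ n, (mv (a ^ n)) = !![z ^ n, 0; 0, (-z ^ 3) ^ n] := by
    intro n
    rw [← diag_pow, ← ha, mv_pow]
  have hv0 : v ≠ 0 := by rcases hv with rfl | rfl <;> simp [hz0]
  have t2 : (mv (t ^ 2)) = !![h * (-1 - z ^ 2), h * (1 - z ^ 2); h * (-1 - z ^ 2), h * (-1 + z ^ 2)] := by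
    rw [pow_two, mv_mul, ht]
    ext i j; fin_cases i <;> fin_cases j <;> simp <;> grind
  have h8 : a ^ 8 = 1 := by
    apply mv_ext; rw [apow, mv_one]
    ext i j; fin_cases i <;> fin_cases j <;> simp <;> grind
  have hw2 : w ^ 2 = a ^ 4 := by
    apply mv_ext; rw [apow, pow_two, mv_mul, hw]
    ext i j; fin_cases i <;> fin_cases j <;> simp <;> grind
  have hwa : a * w = w * a ^ 7 := by
    apply mv_ext; simp only [mv_mul]; rw [apow, hw, ha]
    ext i j; fin_cases i <;> fin_cases j <;> simp <;> grind
  have ht3 : t ^ 3 = a ^ 4 := by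
    apply mv_ext; rw [pow_succ, mv_mul, apow, t2, ht]
    ext i j; fin_cases i <;> fin_cases j <;> simp <;> grind
  have hat : ∃ i < 8, a * t = t ^ 2 * (w ^ 1 * a ^ i) := by
    rcases hv with rfl | rfl
    · refine ⟨7, by norm_num, ?_⟩
      apply mv_ext; rw [pow_one]; simp only [mv_mul]
      rw [apow, t2, hw, ha, ht]
      ext i j; fin_cases i <;> fin_cases j <;> simp <;> grind
    · refine ⟨3, by norm_num, ?_⟩
      apply mv_ext; rw [pow_one]; simp only [mv_mul]
      rw [apow, t2, hw, ha, ht]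
      ext i j; fin_cases i <;> fin_cases j <;> simp <;> grind
  have hat2 : a * t ^ 2 = t * a ^ 7 := by
    apply mv_ext; simp only [mv_mul]
    rw [apow, t2, ha, ht]
    ext i j; fin_cases i <;> fin_cases j <;> simp <;> grind
  have hwt : w * t = t * (w * a ^ 6) := by
    apply mv_ext; simp only [mv_mul]
    rw [apow, hw, ht]
    ext i j; fin_cases i <;> fin_cases j <;> simp <;> grind
  have hwt2 : ∃ i < 8, w * t ^ 2 = t ^ 2 * a ^ i := by
    rcases hv with rfl | rfl
    · refine ⟨2, by norm_num, ?_⟩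
      apply mv_ext; simp only [mv_mul]
      rw [apow, t2, hw]
      ext i j; fin_cases i <;> fin_cases j <;> simp <;> grind
    · refine ⟨6, by norm_num, ?_⟩
      apply mv_ext; simp only [mv_mul]
      rw [apow, t2, hw]
      ext i j; fin_cases i <;> fin_cases j <;> simp <;> grind
  have key := octSet_eq h8 hw2 hwa ht3 hat hat2 hwt hwt2
  have card := octSet_card (a := a) (w := w) (t := t) ?_
  · rw [← key] at card; exact card
  have hp : 1 + z ^ 2 ≠ 0 := by
    intro h; apply h20; linear_combination (1 - z^2) * h + hz
  have hm : 1 - z ^ 2 ≠ 0 := by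
    intro h; apply h20; linear_combination (1 + z^2) * h + hz
  have hp' : -1 - z ^ 2 ≠ 0 := by
    intro h; apply hp; linear_combination -h
  -- monomial elements
  have e0 : ∀ i, (mv (w ^ 0 * a ^ i)) = !![z ^ i, 0; 0, (-z ^ 3) ^ i] := by
    intro i; rw [pow_zero, one_mul, apow]
  have e1 : ∀ i, (mv (w ^ 1 * a ^ i)) = !![0, v * (-z ^ 3) ^ i; v * z ^ i, 0] := by
    intro i; rw [pow_one, mv_mul, apow, hw]
    ext i j; fin_cases i <;> fin_cases j <;> simp
  -- full-support elements
  have f1 : ∀ j < 2, ∀ i, (mv (w ^ j * a ^ i)) 0 0 = 0 ∨ (mv (w ^ j * a ^ i)) 0 1 = 0 := by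
    intro j hj i
    interval_cases j
    · right; rw [e0]; simp
    · left; rw [e1]; simp
  have hz3 : -z ^ 3 ≠ 0 := by simp [hz0]
  have f2 : ∀ j < 2, ∀ i, ∀ x : SL2 k, (mv x) 0 0 ≠ 0 → (mv x) 0 1 ≠ 0 →
      (mv (x * (w ^ j * a ^ i))) 0 0 ≠ 0 ∧ (mv (x * (w ^ j * a ^ i))) 0 1 ≠ 0 := by
    intro j hj i x h0 h1
    rw [mv_mul]
    interval_cases j
    · rw [e0]; simp [Matrix.mul_apply, Fin.sum_univ_two, h0, h1, hz0]
    · rw [e1]; simp [Matrix.mul_apply, Fin.sum_univ_two, h0, h1, hz0, hv0]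
  have t00 : (mv t) 0 0 ≠ 0 := by rw [ht]; simp [hh0, hm]
  have t01 : (mv t) 0 1 ≠ 0 := by rw [ht]; simp [hh0, hm]
  have s00 : (mv (t ^ 2)) 0 0 ≠ 0 := by rw [t2]; simp [hh0, hp']
  have s01 : (mv (t ^ 2)) 0 1 ≠ 0 := by rw [t2]; simp [hh0, hm]
  have f3 : ∀ x : SL2 k, (mv x) 0 0 ≠ 0 → (mv x) 0 1 ≠ 0 → ∀ j < 2, ∀ i, ∀ j' < 2, ∀ i',
      x * (w ^ j * a ^ i) ≠ w ^ j' * a ^ i' := by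
    intro x h0 h1 j hj i j' hj' i' h
    have := f2 j hj i x h0 h1
    rw [h] at this
    rcases f1 j' hj' i' with h | h
    · exact this.1 h
    · exact this.2 h
  have f4 : ∀ m m', m < m' → m' < 3 → ∀ j < 2, ∀ i, ∀ j' < 2, ∀ i',
      t ^ m * (w ^ j * a ^ i) ≠ t ^ m' * (w ^ j' * a ^ i') := by
    intro m m' hmm hm' j hj i j' hj' i' h
    obtain ⟨d, rfl⟩ := Nat.exists_eq_add_of_lt hmm
    rw [add_assoc, pow_add, mul_assoc] at h
    have h := (mul_left_cancel h).symm
    have hd : d < 2 := by omega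
    interval_cases d
    · exact f3 (t ^ (0 + 1)) (by simpa using t00) (by simpa using t01) _ hj' _ _ hj _ h
    · exact f3 (t ^ (1 + 1)) s00 s01 _ hj' _ _ hj _ h
  intro m hm j hj i hi m' hm' j' hj' i' hi' h
  have hmm : m = m' := by
    rcases lt_trichotomy m m' with hl | hl | hl
    · exact absurd h (f4 m m' hl hm' j hj i j' hj' i')
    · exact hl
    · exact absurd h.symm (f4 m' m hl hm j' hj' i' j hj i)
  subst hmm
  have h := congrArg mv (mul_left_cancel h)
  refine ⟨rfl, ?_⟩
  interval_cases j <;> interval_cases j'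
  · rw [e0, e0] at h
    have h := congrFun (congrFun h 0) 0
    simp only [of_apply, cons_val', cons_val_zero, cons_val_fin_one] at h
    exact ⟨rfl, hz8.pow_inj hi hi' h⟩
  · rw [e0, e1] at h
    have h := congrFun (congrFun h 0) 0
    simp [hz0] at h
  · rw [e0, e1] at h
    have h := congrFun (congrFun h 0) 0
    simp only [of_apply, cons_val', cons_val_zero, cons_val_fin_one] at h
    exact absurd h.symm (pow_ne_zero _ hz0)
  · rw [e1, e1] at h
    have h := congrFun (congrFun h 1) 0
    simp [hv0] at h
    exact ⟨rfl, hz8.pow_inj hi hi' h⟩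

end concrete

/-- over an algebraically closed field in which `48` is nonzero, the binary
octahedral group, i.e. the subgroup of `SL₂(k)` generated by `diag(ζ₈, ζ₈⁻¹)`,
`[[0, ζ₄], [ζ₄, 0]]` and `s⁻¹ • [[ζ₈⁷, ζ₈⁷], [ζ₈⁵, ζ₈]]` with `s = ζ₈ + ζ₈⁻¹`,
is a finite group of order `48`. -/
theorem binary_octahedral_card (k : Type*) [Field k] [IsAlgClosed k]
    (hchar : (48 : k) ≠ 0)
    (ζ₄ : k) (hζ₄ : IsPrimitiveRoot ζ₄ 4)
    (ζ₈ : k) (hζ₈ : IsPrimitiveRoot ζ₈ 8) :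
    letI G : Subgroup (SL2 k) := matGen
      {!![ζ₈, 0; 0, ζ₈⁻¹], !![0, ζ₄; ζ₄, 0],
        (ζ₈ + ζ₈⁻¹)⁻¹ • !![ζ₈ ^ 7, ζ₈ ^ 7; ζ₈ ^ 5, ζ₈]}
    Finite G ∧ Nat.card G = 48 := by
  have h20 : (2 : k) ≠ 0 := by
    intro h; apply hchar; linear_combination 24 * h
  obtain ⟨h, hh⟩ : ∃ h : k, 2 * h = 1 := ⟨2⁻¹, mul_inv_cancel₀ h20⟩
  have hz : ζ₈ ^ 4 = -1 := by
    have h1 : (ζ₈ ^ 4) ^ 2 = 1 := by rw [← pow_mul]; exact hζ₈.pow_eq_one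
    rcases mul_self_eq_one_iff.mp ((pow_two _).symm.trans h1) with h | h
    · exact absurd h (hζ₈.pow_ne_one_of_pos_of_lt (by norm_num) (by norm_num))
    · exact h
  have hq : ζ₄ ^ 2 = -1 := by
    have h1 : (ζ₄ ^ 2) ^ 2 = 1 := by rw [← pow_mul]; exact hζ₄.pow_eq_one
    rcases mul_self_eq_one_iff.mp ((pow_two _).symm.trans h1) with h | h
    · exact absurd h (hζ₄.pow_ne_one_of_pos_of_lt (by norm_num) (by norm_num))
    · exact h
  have hv : ζ₄ = ζ₈ ^ 2 ∨ ζ₄ = - ζ₈ ^ 2 := by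
    apply sq_eq_sq_iff_eq_or_eq_neg.mp
    linear_combination hq - hz
  have hinv : ζ₈⁻¹ = - ζ₈ ^ 3 := by
    apply inv_eq_of_mul_eq_one_right; linear_combination -hz
  have hs : (ζ₈ + ζ₈⁻¹)⁻¹ = h * (ζ₈ - ζ₈ ^ 3) := by
    rw [hinv]
    apply inv_eq_of_mul_eq_one_right; grind
  have hA : (!![ζ₈, 0; 0, -ζ₈ ^ 3] : Matrix (Fin 2) (Fin 2) k).det = 1 := by
    rw [det_fin_two_of]; linear_combination -hz
  have hW : (!![0, ζ₄; ζ₄, 0] : Matrix (Fin 2) (Fin 2) k).det = 1 := by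
    rw [det_fin_two_of]; linear_combination -hq
  have hT : (!![h * (1 - ζ₈ ^ 2), h * (1 - ζ₈ ^ 2); h * (-1 - ζ₈ ^ 2), h * (1 + ζ₈ ^ 2)] :
      Matrix (Fin 2) (Fin 2) k).det = 1 := by
    rw [det_fin_two_of]; grind
  have hTe : (ζ₈ + ζ₈⁻¹)⁻¹ • !![ζ₈ ^ 7, ζ₈ ^ 7; ζ₈ ^ 5, ζ₈] =
      !![h * (1 - ζ₈ ^ 2), h * (1 - ζ₈ ^ 2); h * (-1 - ζ₈ ^ 2), h * (1 + ζ₈ ^ 2)] := by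
    rw [hs]
    ext i j; fin_cases i <;> fin_cases j <;> simp <;> grind
  have hset : {g : SL2 k | (g : Matrix (Fin 2) (Fin 2) k) ∈
      ({!![ζ₈, 0; 0, ζ₈⁻¹], !![0, ζ₄; ζ₄, 0],
        (ζ₈ + ζ₈⁻¹)⁻¹ • !![ζ₈ ^ 7, ζ₈ ^ 7; ζ₈ ^ 5, ζ₈]} : Set (Matrix (Fin 2) (Fin 2) k))} =
      {(⟨_, hA⟩ : SL2 k), ⟨_, hW⟩, ⟨_, hT⟩} := by
    rw [hTe, hinv]
    ext g
    refine Iff.trans ?_ (or_congr Subtype.ext_iff (or_congr Subtype.ext_iff Subtype.ext_iff)).symm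
    exact Iff.rfl
  have := oct_core ζ₈ h ζ₄ hz hh hζ₈ hv ⟨_, hA⟩ ⟨_, hW⟩ ⟨_, hT⟩ rfl rfl rfl
  simp only [matGen]
  rw [hset]
  exact this
end

section
/- Let k be an algebraically closed field in which 120 is nonzero (i.e., char k = 0 or char k ≥ 7). Then the subgroup of SL_2(k) generated by diag(ζ_{10}, ζ_{10}^{-1}), the matrix [[0, 1],[−1, 0]], and (ζ_5² − ζ_5³)^{-1}·[[ζ_5 + ζ_5^{-1}, 1],[1, −(ζ_5 + ζ_5^{-1})]] is a finite group of order 120 (the binary icosahedral group). -/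
open Matrix

namespace BinIco

variable {k : Type*} [Field k]

/-- diagonal elements -/
def mD (x : k) : Matrix (Fin 2) (Fin 2) k := !![x, 0; 0, x⁻¹]
/-- the Weyl element -/
def mW : Matrix (Fin 2) (Fin 2) k := !![0, 1; -1, 0]
/-- the antidiagonal elements -/
def mA (x : k) : Matrix (Fin 2) (Fin 2) k := !![0, x; -x⁻¹, 0]
/-- the third generator -/
def mT (c a : k) : Matrix (Fin 2) (Fin 2) k := !![c * a, c; c, -(c * a)]
/-- generic elements, first kind -/
def mB (c a p v : k) : Matrix (Fin 2) (Fin 2) k :=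
  !![c * a * p, c * (p * v); c * (p⁻¹ * v⁻¹), -(c * a * p⁻¹)]
/-- generic elements, second kind -/
def mC (c a p v : k) : Matrix (Fin 2) (Fin 2) k :=
  !![-(c * (p * v)), c * a * p; c * a * p⁻¹, c * (p⁻¹ * v⁻¹)]

/-- the explicit list of elements -/
inductive Mem (c a : k) : Matrix (Fin 2) (Fin 2) k → Prop
  | D (x : k) (hx : x ^ 10 = 1) : Mem c a (mD x)
  | A (x : k) (hx : x ^ 10 = 1) : Mem c a (mA x)
  | B (p v : k) (hp : p ^ 10 = 1) (hv : v ^ 5 = 1) : Mem c a (mB c a p v)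
  | C (p v : k) (hp : p ^ 10 = 1) (hv : v ^ 5 = 1) : Mem c a (mC c a p v)

theorem ne0 {x : k} {n : ℕ} (hn : n ≠ 0) (hx : x ^ n = 1) : x ≠ 0 := by
  rintro rfl
  simp [hn] at hx

theorem neg10 {x : k} (hx : x ^ 10 = 1) : (-x) ^ 10 = 1 := by
  rw [← hx]; ring

theorem inv_n {x : k} {n : ℕ} (hx : x ^ n = 1) : (x⁻¹) ^ n = 1 := by
  rw [inv_pow, hx, inv_one]

theorem mul_n {x y : k} {n : ℕ} (hx : x ^ n = 1) (hy : y ^ n = 1) : (x * y) ^ n = 1 := by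
  rw [mul_pow, hx, hy, one_mul]

theorem pow_n {x : k} {n : ℕ} (m : ℕ) (hx : x ^ n = 1) : (x ^ m) ^ n = 1 := by
  rw [← pow_mul, mul_comm, pow_mul, hx, one_pow]

theorem five_ten {x : k} (hx : x ^ 5 = 1) : x ^ 10 = 1 := by
  rw [show x ^ 10 = (x ^ 5) ^ 2 by ring, hx, one_pow]

theorem Mem.D_mul {c a : k} {M : Matrix (Fin 2) (Fin 2) k} (hM : Mem c a M) (y : k)
    (hy : y ^ 10 = 1) : Mem c a (mD y * M) := by
  cases hM with
  | D x hx =>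
    have : mD y * mD x = mD (y * x) := by
      ext i j; fin_cases i <;> fin_cases j <;> simp [mD, Matrix.mul_apply, Fin.sum_univ_two] <;> ring
    rw [this]; exact .D _ (mul_n hy hx)
  | A x hx =>
    have : mD y * mA x = mA (y * x) := by
      ext i j; fin_cases i <;> fin_cases j <;>
        simp [mD, mA, Matrix.mul_apply, Fin.sum_univ_two] <;> ring
    rw [this]; exact .A _ (mul_n hy hx)
  | B p v hp hv =>
    have : mD y * mB c a p v = mB c a (y * p) v := by
      ext i j; fin_cases i <;> fin_cases j <;>
        simp [mD, mB, Matrix.mul_apply, Fin.sum_univ_two] <;> ring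
    rw [this]; exact .B _ _ (mul_n hy hp) hv
  | C p v hp hv =>
    have : mD y * mC c a p v = mC c a (y * p) v := by
      ext i j; fin_cases i <;> fin_cases j <;>
        simp [mD, mC, Matrix.mul_apply, Fin.sum_univ_two] <;> ring
    rw [this]; exact .C _ _ (mul_n hy hp) hv

theorem Mem.neg {c a : k} {M : Matrix (Fin 2) (Fin 2) k} (hM : Mem c a M) : Mem c a (-M) := by
  have h := hM.D_mul (-1) (by norm_num)
  have : mD (-1) * M = -M := by
    ext i j; fin_cases i <;> simp [mD, Matrix.mul_apply, Fin.sum_univ_two, inv_neg]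
  rwa [this] at h

theorem mD_mul_mW (x : k) : mD x * mW = mA x := by
  ext i j; fin_cases i <;> fin_cases j <;> simp [mD, mA, mW, Matrix.mul_apply, Fin.sum_univ_two]

theorem mB_mul_mW (c a p v : k) : mB c a p v * mW = mC c a p v := by
  ext i j; fin_cases i <;> fin_cases j <;> simp [mB, mC, mW, Matrix.mul_apply, Fin.sum_univ_two]

theorem mW_mul_mW : (mW : Matrix (Fin 2) (Fin 2) k) * mW = -1 := by
  ext i j; fin_cases i <;> fin_cases j <;> simp [mW, Matrix.mul_apply, Fin.sum_univ_two]

theorem Mem.mul_W {c a : k} {M : Matrix (Fin 2) (Fin 2) k} (hM : Mem c a M) :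
    Mem c a (M * mW) := by
  cases hM with
  | D x hx => rw [mD_mul_mW]; exact .A _ hx
  | A x hx =>
    rw [← mD_mul_mW, Matrix.mul_assoc, mW_mul_mW, mul_neg, mul_one]
    exact (Mem.D _ hx).neg
  | B p v hp hv => rw [mB_mul_mW]; exact .C _ _ hp hv
  | C p v hp hv =>
    rw [← mB_mul_mW, Matrix.mul_assoc, mW_mul_mW, mul_neg, mul_one]
    exact (Mem.B _ _ hp hv).neg

theorem Mem.W_mul {c a : k} {M : Matrix (Fin 2) (Fin 2) k} (hM : Mem c a M) :
    Mem c a (mW * M) := by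
  cases hM with
  | D x hx =>
    have : mW * mD x = mA (x⁻¹) := by
      ext i j; fin_cases i <;> fin_cases j <;> simp [mD, mA, mW, Matrix.mul_apply, Fin.sum_univ_two]
    rw [this]; exact .A _ (inv_n hx)
  | A x hx =>
    have : mW * mA x = mD (-x⁻¹) := by
      ext i j; fin_cases i <;> fin_cases j <;>
        simp [mD, mA, mW, Matrix.mul_apply, Fin.sum_univ_two, inv_neg]
    rw [this]; exact .D _ (neg10 (inv_n hx))
  | B p v hp hv =>
    have : mW * mB c a p v = mC c a (-p⁻¹) v⁻¹ := by
      ext i j; fin_cases i <;> fin_cases j <;>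
        simp [mB, mC, mW, Matrix.mul_apply, Fin.sum_univ_two, inv_neg]
    rw [this]; exact .C _ _ (neg10 (inv_n hp)) (inv_n hv)
  | C p v hp hv =>
    have : mW * mC c a p v = mB c a p⁻¹ v⁻¹ := by
      ext i j; fin_cases i <;> fin_cases j <;>
        simp [mB, mC, mW, Matrix.mul_apply, Fin.sum_univ_two]
    rw [this]; exact .B _ _ (inv_n hp) (inv_n hv)

theorem Mem.T_D {c a x : k} (hx : x ^ 10 = 1) : Mem c a (mT c a * mD x) := by
  have h0 := ne0 (by norm_num) hx
  have : mT c a * mD x = mB c a x ((x⁻¹) ^ 2) := by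
    ext i j; fin_cases i <;> fin_cases j <;>
      simp [mB, mT, mD, Matrix.mul_apply, Fin.sum_univ_two] <;> field_simp <;> simp
  rw [this]
  refine .B _ _ hx ?_
  rw [← pow_mul]; exact inv_n hx

theorem cases5 {z t : k} (hz : IsPrimitiveRoot z 5) (ht : t ^ 5 = 1) :
    t = 1 ∨ t = z ∨ t = z ^ 2 ∨ t = z ^ 3 ∨ t = z ^ 4 := by
  obtain ⟨i, hi, rfl⟩ := hz.eq_pow_of_pow_eq_one ht
  interval_cases i <;> simp

theorem phi5 {z : k} (hz : IsPrimitiveRoot z 5) : z ^ 4 + z ^ 3 + z ^ 2 + z + 1 = 0 := by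
  have h1 : z ≠ 1 := hz.ne_one (by norm_num)
  have h5 := hz.pow_eq_one
  have : (z - 1) * (z ^ 4 + z ^ 3 + z ^ 2 + z + 1) = 0 := by linear_combination h5
  exact (mul_eq_zero.mp this).resolve_left (sub_ne_zero.mpr h1)

theorem T_B_toB {c a p v α β : k} (hp : p ≠ 0) (hα : α ≠ 0) (hβ : β ≠ 0)
    (hv : v = β ^ 2 * (p⁻¹) ^ 2)
    (e1 : c * (a ^ 2 * β ^ 2 + 1) = a * α) (e2 : c * a * (β ^ 2 - 1) = β)
    (e3 : c * (a ^ 2 + β ^ 2) * α = -(a * β ^ 2)) :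
    mT c a * mB c a p v = mB c a (α * (β⁻¹) ^ 2 * p) (β ^ 3 * α⁻¹ * (p⁻¹) ^ 2) := by
  subst hv
  ext i j
  fin_cases i <;> fin_cases j <;> simp [mT, mB, Matrix.mul_apply, Fin.sum_univ_two] <;> field_simp
  · linear_combination c * e1
  · linear_combination c * e2
  · linear_combination c * e2
  · linear_combination c * e3

theorem T_B_toC {c a p v γ δ : k} (hp : p ≠ 0) (hγ : γ ≠ 0) (hδ : δ ≠ 0)
    (hv : v = δ ^ 2 * (p⁻¹) ^ 2)
    (e1 : c * (a ^ 2 * δ ^ 2 + 1) = γ) (e2 : c * (δ ^ 2 - 1) = δ)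
    (e3 : c * (a ^ 2 + δ ^ 2) * γ = - δ ^ 2) :
    mT c a * mB c a p v = mC c a (δ * p⁻¹) (-(γ * (δ⁻¹) ^ 3 * p ^ 2)) := by
  subst hv
  ext i j
  fin_cases i <;> fin_cases j <;>
    simp [mT, mB, mC, Matrix.mul_apply, Fin.sum_univ_two, inv_neg] <;> field_simp
  · linear_combination c * e1
  · linear_combination c * a * e2
  · linear_combination c * a * e2
  · linear_combination c * e3

theorem T_B_toD {c a p v : k} (hp : p ≠ 0)
    (hv : v = (p⁻¹) ^ 2) (e : c ^ 2 * (a ^ 2 + 1) = -1) :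
    mT c a * mB c a p v = mD (-p) := by
  subst hv
  ext i j
  fin_cases i <;> fin_cases j <;>
    simp [mT, mB, mD, Matrix.mul_apply, Fin.sum_univ_two, inv_neg] <;> field_simp
  · linear_combination e
  · ring
  · ring
  · linear_combination e

theorem csq {z c a : k} (hz : IsPrimitiveRoot z 5) (hc : c * (z ^ 2 - z ^ 3) = 1)
    (ha : a = z + z ^ 4) : c ^ 2 * (a ^ 2 + 1) = -1 := by
  have h5 := hz.pow_eq_one
  have hphi := phi5 hz
  subst ha
  grind

theorem Mem.T_B {z c a p v : k} (hz : IsPrimitiveRoot z 5) (hc : c * (z ^ 2 - z ^ 3) = 1)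
    (ha : a = z + z ^ 4) (hp : p ^ 10 = 1) (hv : v ^ 5 = 1) :
    Mem c a (mT c a * mB c a p v) := by
  have hp0 := ne0 (by norm_num) hp
  have h5 := hz.pow_eq_one
  have hphi := phi5 hz
  have z0 : z ≠ 0 := ne0 (by norm_num) h5
  obtain ⟨t, ht⟩ : ∃ t, t = v * p ^ 2 := ⟨_, rfl⟩
  have hp2 : (p ^ 2) ^ 5 = 1 := by rw [← pow_mul]; exact hp
  have hq2 : (p⁻¹ ^ 2) ^ 5 = 1 := by rw [← pow_mul]; exact inv_n hp
  have ht5 : t ^ 5 = 1 := by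
    rw [ht]; exact mul_n hv hp2
  have hv' : v = t * (p⁻¹) ^ 2 := by rw [ht]; field_simp
  have hz10 := five_ten h5
  have k1 : c * (z - 1) = -z ^ 3 := by grind
  have k4 : c * (z ^ 4 - 1) = z ^ 2 := by grind
  have zp (n : ℕ) : z ^ n ≠ 0 := pow_ne_zero n z0
  rcases cases5 hz ht5 with h | h | h | h | h <;> rw [h] at hv'
  · rw [T_B_toD hp0 (by rw [hv', one_mul]) (csq hz hc ha)]
    exact .D _ (neg10 hp)
  · rw [T_B_toC (γ := z ^ 4) (δ := -z ^ 3) hp0 (zp 4) (neg_ne_zero.mpr (zp 3))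
      (by rw [hv']; linear_combination -(z * p⁻¹ ^ 2) * h5)
      (by subst ha; grind) (by subst ha; grind) (by subst ha; grind)]
    refine .C _ _ (mul_n (neg10 (pow_n _ hz10)) (inv_n hp)) ?_
    have : -(z ^ 4 * (-z ^ 3)⁻¹ ^ 3 * p ^ 2) = z ^ 4 * ((z ^ 3)⁻¹) ^ 3 * p ^ 2 := by
      rw [inv_neg]; ring
    rw [this]
    exact mul_n (mul_n (pow_n _ h5) (pow_n _ (inv_n (pow_n _ h5)))) hp2
  · rw [T_B_toB (α := z ^ 4) (β := z) hp0 (zp 4) z0 hv'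
      (by subst ha; grind) (by subst ha; grind) (by subst ha; grind)]
    exact .B _ _ (mul_n (mul_n (pow_n _ hz10) (pow_n _ (inv_n hz10))) hp)
      (mul_n (mul_n (pow_n _ h5) (inv_n (pow_n _ h5))) hq2)
  · rw [T_B_toB (α := -z) (β := -z ^ 4) hp0 (neg_ne_zero.mpr z0) (neg_ne_zero.mpr (zp 4))
      (by rw [hv']; linear_combination -(z ^ 3 * p⁻¹ ^ 2) * h5)
      (by subst ha; grind) (by subst ha; grind) (by subst ha; grind)]
    refine .B _ _ (mul_n (mul_n (neg10 hz10) (pow_n _ (inv_n (neg10 (pow_n _ hz10))))) hp) ?_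
    have : (-z ^ 4) ^ 3 * (-z)⁻¹ * p⁻¹ ^ 2 = (z ^ 4) ^ 3 * z⁻¹ * p⁻¹ ^ 2 := by
      rw [inv_neg]; ring
    rw [this]
    exact mul_n (mul_n (pow_n _ (pow_n _ h5)) (inv_n h5)) hq2
  · rw [T_B_toC (γ := -z) (δ := z ^ 2) hp0 (neg_ne_zero.mpr z0) (zp 2)
      (by rw [hv']; ring)
      (by subst ha; grind) (by subst ha; grind) (by subst ha; grind)]
    refine .C _ _ (mul_n (pow_n _ hz10) (inv_n hp)) ?_
    have : -(-z * (z ^ 2)⁻¹ ^ 3 * p ^ 2) = z * ((z ^ 2)⁻¹) ^ 3 * p ^ 2 := by ring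
    rw [this]
    exact mul_n (mul_n h5 (pow_n _ (inv_n (pow_n _ h5)))) hp2

theorem Mem.T_mul {z c a : k} (hz : IsPrimitiveRoot z 5) (hc : c * (z ^ 2 - z ^ 3) = 1)
    (ha : a = z + z ^ 4) {M : Matrix (Fin 2) (Fin 2) k} (hM : Mem c a M) :
    Mem c a (mT c a * M) := by
  cases hM with
  | D x hx => exact .T_D hx
  | A x hx => rw [← mD_mul_mW, ← Matrix.mul_assoc]; exact (Mem.T_D hx).mul_W
  | B p v hp hv => exact .T_B hz hc ha hp hv
  | C p v hp hv =>
    rw [← mB_mul_mW, ← Matrix.mul_assoc]; exact (Mem.T_B hz hc ha hp hv).mul_W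

theorem mT_eq {z c a : k} (hz : IsPrimitiveRoot z 5) (hcd : c = (z ^ 2 - z ^ 3)⁻¹)
    (ha : a = z + z ^ 4) : (z ^ 2 - z ^ 3)⁻¹ • !![z + z⁻¹, 1; 1, -(z + z⁻¹)] = mT c a := by
  have zi1 : z⁻¹ = z ^ 4 :=
    inv_eq_of_mul_eq_one_right (by linear_combination hz.pow_eq_one)
  rw [zi1, ← hcd, ← ha]
  ext i j; fin_cases i <;> fin_cases j <;> simp [mT]

/-- roots of unity -/
abbrev Mu (k : Type*) [Field k] (n : ℕ) := {x : k // x ∈ Polynomial.nthRootsFinset n (1 : k)}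

theorem Mu.pow {n : ℕ} [NeZero n] (x : Mu k n) : x.1 ^ n = 1 :=
  (Polynomial.mem_nthRootsFinset (Nat.pos_of_ne_zero (NeZero.ne n)) 1).mp x.2

/-- the parametrisation -/
def par (c a : k) : (Mu k 10 ⊕ Mu k 10) ⊕ ((Mu k 10 × Mu k 5) ⊕ (Mu k 10 × Mu k 5)) →
    Matrix (Fin 2) (Fin 2) k
  | .inl (.inl x) => mD x.1
  | .inl (.inr x) => mA x.1
  | .inr (.inl x) => mB c a x.1.1 x.2.1
  | .inr (.inr x) => mC c a x.1.1 x.2.1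

theorem mem_range_par {c a : k} (M : Matrix (Fin 2) (Fin 2) k) :
    M ∈ Set.range (par c a) ↔ Mem c a M := by
  have m10 : ∀ x : k, x ^ 10 = 1 → x ∈ Polynomial.nthRootsFinset 10 (1 : k) := fun x hx =>
    (Polynomial.mem_nthRootsFinset (by norm_num) 1).mpr hx
  have m5 : ∀ x : k, x ^ 5 = 1 → x ∈ Polynomial.nthRootsFinset 5 (1 : k) := fun x hx =>
    (Polynomial.mem_nthRootsFinset (by norm_num) 1).mpr hx
  constructor
  · rintro ⟨(x | x) | (⟨x, y⟩ | ⟨x, y⟩), rfl⟩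
    · exact .D _ x.pow
    · exact .A _ x.pow
    · exact .B _ _ x.pow y.pow
    · exact .C _ _ x.pow y.pow
  · intro h
    cases h with
    | D x hx => exact ⟨.inl (.inl ⟨x, m10 x hx⟩), rfl⟩
    | A x hx => exact ⟨.inl (.inr ⟨x, m10 x hx⟩), rfl⟩
    | B p v hp hv => exact ⟨.inr (.inl (⟨p, m10 p hp⟩, ⟨v, m5 v hv⟩)), rfl⟩
    | C p v hp hv => exact ⟨.inr (.inr (⟨p, m10 p hp⟩, ⟨v, m5 v hv⟩)), rfl⟩

theorem par_inj {c a : k} (hc : c ≠ 0) (ha : a ≠ 0) (haa : a ^ 2 ≠ 1) :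
    Function.Injective (par c a) := by
  have n0 : ∀ x : Mu k 10, x.1 ≠ 0 := fun x => ne0 (by norm_num) x.pow
  have m0 : ∀ x : Mu k 5, x.1 ≠ 0 := fun x => ne0 (by norm_num) x.pow
  have hBC : ∀ p v q w : k, p ≠ 0 → v ≠ 0 → q ≠ 0 → w ≠ 0 → mB c a p v ≠ mC c a q w := by
    intro p v q w hp hv hq hw h
    have e1 := congrFun (congrFun h 0) 0
    have e2 := congrFun (congrFun h 1) 1
    simp [mB, mC] at e1 e2
    apply haa
    have e3 : a * p = -(q * w) := mul_left_cancel₀ hc (by linear_combination e1)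
    have e4 : -(a * p⁻¹) = q⁻¹ * w⁻¹ := mul_left_cancel₀ hc (by linear_combination e2)
    have e5 : (a * p) * (-(a * p⁻¹)) = -(q * w) * (q⁻¹ * w⁻¹) := by rw [e3, e4]
    field_simp at e5
    linear_combination -e5
  rintro ((x | x) | (⟨x, y⟩ | ⟨x, y⟩)) ((x' | x') | (⟨x', y'⟩ | ⟨x', y'⟩)) h <;>
    simp only [par] at h <;>
    have h00 := congrFun (congrFun h 0) 0 <;>
    have h01 := congrFun (congrFun h 0) 1
  · simp [mD] at h00; simp [Subtype.ext_iff, h00]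
  · simp [mD, mA, n0] at h00
  · simp [mD, mB, n0, m0, hc] at h01
  · simp [mD, mC, n0, ha, hc] at h01
  · simp [mD, mA, n0] at h01
  · simp [mA] at h01; simp [Subtype.ext_iff, h01]
  · simp [mA, mB, n0, ha, hc] at h00
  · simp [mA, mC, n0, m0, hc] at h00
  · simp [mD, mB, n0, m0, hc] at h01
  · simp [mA, mB, n0, ha, hc] at h00
  · simp [mB, ha, hc] at h00 h01
    rw [h00] at h01
    have := mul_left_cancel₀ (n0 x') h01
    simp [Subtype.ext_iff, h00, this]
  · exact absurd h (hBC _ _ _ _ (n0 _) (m0 _) (n0 _) (m0 _))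
  · simp [mD, mC, n0, ha, hc] at h01
  · simp [mA, mC, n0, m0, hc] at h00
  · exact absurd h.symm (hBC _ _ _ _ (n0 _) (m0 _) (n0 _) (m0 _))
  · simp [mC, ha, hc] at h00 h01
    rw [h01] at h00
    have := mul_left_cancel₀ (n0 x') h00
    simp [Subtype.ext_iff, h01, this]

theorem ncard_range_par {c a x z : k} (hx : IsPrimitiveRoot x 10) (hz : IsPrimitiveRoot z 5)
    (hc : c ≠ 0) (ha : a ≠ 0) (haa : a ^ 2 ≠ 1) : (Set.range (par c a)).ncard = 120 := by
  rw [← Nat.card_coe_set_eq, Nat.card_range_of_injective (par_inj hc ha haa)]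
  have h10 : Nat.card (Mu k 10) = 10 := by
    rw [Nat.card_eq_fintype_card, Fintype.card_coe, hx.card_nthRootsFinset]
  have h5 : Nat.card (Mu k 5) = 5 := by
    rw [Nat.card_eq_fintype_card, Fintype.card_coe, hz.card_nthRootsFinset]
  rw [Nat.card_sum, Nat.card_sum, Nat.card_sum, Nat.card_prod, h10, h5]

theorem exists_mem_of_Mem {c a x : k} (hx : IsPrimitiveRoot x 10)
    (e : c ^ 2 * (a ^ 2 + 1) = -1) {M : Matrix (Fin 2) (Fin 2) k} (hM : Mem c a M) :
    ∃ g ∈ matGen ({mD x, mW, mT c a} : Set (Matrix (Fin 2) (Fin 2) k)), g.1 = M := by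
  have hD : ∀ y : k, y ^ 10 = 1 →
      ∃ g ∈ matGen ({mD x, mW, mT c a} : Set (Matrix (Fin 2) (Fin 2) k)), g.1 = mD y := by
    intro y hy
    obtain ⟨i, -, rfl⟩ := hx.eq_pow_of_pow_eq_one hy
    have hx0 : x ≠ 0 := hx.ne_zero (by norm_num)
    let g : SL2 k := ⟨mD x, by simp [mD, Matrix.det_fin_two, hx0]⟩
    have hg : g ∈ matGen ({mD x, mW, mT c a} : Set (Matrix (Fin 2) (Fin 2) k)) :=
      Subgroup.subset_closure (Or.inl rfl)
    refine ⟨g ^ i, pow_mem hg i, ?_⟩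
    change (↑(g ^ i) : Matrix (Fin 2) (Fin 2) k) = _
    rw [Matrix.SpecialLinearGroup.coe_pow]
    change (mD x) ^ i = _
    induction i with
    | zero => simp [mD, Matrix.one_fin_two]
    | succ n ih =>
      rw [pow_succ, ih (pow_n _ hx.pow_eq_one)]
      ext i j; fin_cases i <;> fin_cases j <;>
        simp [mD, Matrix.mul_apply, Fin.sum_univ_two] <;> ring
  obtain ⟨w, hw, hw1⟩ : ∃ g ∈ matGen ({mD x, mW, mT c a} : Set (Matrix (Fin 2) (Fin 2) k)),
      g.1 = mW :=
    ⟨⟨mW, by simp [mW, Matrix.det_fin_two]⟩, Subgroup.subset_closure (Or.inr (Or.inl rfl)), rfl⟩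
  obtain ⟨t, ht, ht1⟩ : ∃ g ∈ matGen ({mD x, mW, mT c a} : Set (Matrix (Fin 2) (Fin 2) k)),
      g.1 = mT c a :=
    ⟨⟨mT c a, by simp [mT, Matrix.det_fin_two]; linear_combination -e⟩,
      Subgroup.subset_closure (Or.inr (Or.inr rfl)), rfl⟩
  have hB : ∀ p v : k, p ^ 10 = 1 → v ^ 5 = 1 →
      ∃ g ∈ matGen ({mD x, mW, mT c a} : Set (Matrix (Fin 2) (Fin 2) k)), g.1 = mB c a p v := by
    intro p v hp hv
    obtain ⟨g, hg, hg1⟩ := hD (p * v ^ 3) (mul_n hp (pow_n _ (five_ten hv)))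
    obtain ⟨u, hu, hu1⟩ := hD (v ^ 2) (pow_n _ (five_ten hv))
    refine ⟨g * t * u, mul_mem (mul_mem hg ht) hu, ?_⟩
    change g.1 * t.1 * u.1 = _
    rw [hg1, hu1, ht1]
    have hp0 := ne0 (by norm_num) hp
    have hv0 := ne0 (by norm_num) hv
    ext i j; fin_cases i <;> fin_cases j <;>
      simp [mD, mT, mB, Matrix.mul_apply, Fin.sum_univ_two] <;> field_simp <;>
      simp [hv]
  cases hM with
  | D y hy => exact hD y hy
  | A y hy =>
    obtain ⟨g, hg, hg1⟩ := hD y hy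
    refine ⟨g * w, mul_mem hg hw, ?_⟩
    change g.1 * w.1 = _
    rw [hg1, hw1, mD_mul_mW]
  | B p v hp hv => exact hB p v hp hv
  | C p v hp hv =>
    obtain ⟨g, hg, hg1⟩ := hB p v hp hv
    refine ⟨g * w, mul_mem hg hw, ?_⟩
    change g.1 * w.1 = _
    rw [hg1, hw1, mB_mul_mW]

theorem Mem_of_mem {z c a x : k} (hx : IsPrimitiveRoot x 10)
    (hz : IsPrimitiveRoot z 5) (hc : c * (z ^ 2 - z ^ 3) = 1) (ha : a = z + z ^ 4)
    (g : SL2 k) (hg : g ∈ matGen ({mD x, mW, mT c a} : Set (Matrix (Fin 2) (Fin 2) k))) :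
    Mem c a g.1 := by
  have e := csq hz hc ha
  have inv_mul : ∀ (h y : SL2 k), ((h⁻¹ * y : SL2 k) : Matrix (Fin 2) (Fin 2) k)
      = Matrix.adjugate h.1 * y.1 := by
    intro h y
    simp
  induction hg using Subgroup.closure_induction_left with
  | one =>
    have : ((1 : SL2 k) : Matrix (Fin 2) (Fin 2) k) = mD 1 := by
      simp [mD, Matrix.one_fin_two]
    rw [this]; exact .D _ (one_pow _)
  | mul_left h hh y hy ih =>
    change Mem c a (h.1 * y.1)
    rcases hh with hh | hh | hh
    · rw [hh]; exact ih.D_mul _ hx.pow_eq_one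
    · rw [hh]; exact ih.W_mul
    · rw [hh]; exact ih.T_mul hz hc ha
  | inv_mul_cancel h hh y hy ih =>
    rw [inv_mul]
    rcases hh with hh | hh | hh
    · rw [hh]
      have : Matrix.adjugate (mD x) = mD x⁻¹ := by simp [mD, Matrix.adjugate_fin_two]
      rw [this]; exact ih.D_mul _ (inv_n hx.pow_eq_one)
    · rw [hh]
      have : Matrix.adjugate (mW : Matrix (Fin 2) (Fin 2) k) = -mW := by
        simp [mW, Matrix.adjugate_fin_two]
      rw [this, neg_mul]; exact ih.W_mul.neg
    · rw [hh]
      have : Matrix.adjugate (mT c a) = -mT c a := by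
        simp [mT, Matrix.adjugate_fin_two]
      rw [this, neg_mul]; exact (ih.T_mul hz hc ha).neg

end BinIco

/-- over an algebraically closed field in which `120` is nonzero, the binary
icosahedral group, i.e. the subgroup of `SL₂(k)` generated by `diag(ζ₁₀, ζ₁₀⁻¹)`,
`[[0, 1], [-1, 0]]` and `(ζ₅² - ζ₅³)⁻¹ • [[ζ₅ + ζ₅⁻¹, 1], [1, -(ζ₅ + ζ₅⁻¹)]]`,
is a finite group of order `120`. -/
theorem binary_icosahedral_card (k : Type*) [Field k] [IsAlgClosed k]
    (hchar : (120 : k) ≠ 0)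
    (ζ₁₀ : k) (hζ₁₀ : IsPrimitiveRoot ζ₁₀ 10)
    (ζ₅ : k) (hζ₅ : IsPrimitiveRoot ζ₅ 5) :
    letI G : Subgroup (SL2 k) := matGen
      {!![ζ₁₀, 0; 0, ζ₁₀⁻¹], !![0, 1; -1, 0],
        (ζ₅ ^ 2 - ζ₅ ^ 3)⁻¹ • !![ζ₅ + ζ₅⁻¹, 1; 1, -(ζ₅ + ζ₅⁻¹)]}
    Finite G ∧ Nat.card G = 120 := by
  have hz0 : ζ₅ ≠ 0 := hζ₅.ne_zero (by norm_num)
  have h1 : ζ₅ ≠ 1 := hζ₅.ne_one (by norm_num)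
  have hphi := BinIco.phi5 hζ₅
  have h5 := hζ₅.pow_eq_one
  have hd : ζ₅ ^ 2 - ζ₅ ^ 3 ≠ 0 := by
    rw [show ζ₅ ^ 2 - ζ₅ ^ 3 = ζ₅ ^ 2 * (1 - ζ₅) by ring]
    exact mul_ne_zero (pow_ne_zero _ hz0) (sub_ne_zero.mpr (Ne.symm h1))
  obtain ⟨c, hcd⟩ : ∃ c, c = (ζ₅ ^ 2 - ζ₅ ^ 3)⁻¹ := ⟨_, rfl⟩
  obtain ⟨a, ha⟩ : ∃ a, a = ζ₅ + ζ₅ ^ 4 := ⟨_, rfl⟩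
  have hc0 : c ≠ 0 := by rw [hcd]; exact inv_ne_zero hd
  have hc : c * (ζ₅ ^ 2 - ζ₅ ^ 3) = 1 := by rw [hcd]; exact inv_mul_cancel₀ hd
  have haq : a ^ 2 + a - 1 = 0 := by
    subst ha; grind
  have ha0 : a ≠ 0 := by
    intro h; rw [h] at haq; norm_num at haq
  have haa : a ^ 2 ≠ 1 := by
    intro h; apply ha0; linear_combination haq - h
  rw [BinIco.mT_eq hζ₅ hcd ha]
  change Finite (matGen {BinIco.mD ζ₁₀, BinIco.mW, BinIco.mT c a}) ∧
    Nat.card (matGen {BinIco.mD ζ₁₀, BinIco.mW, BinIco.mT c a}) = 120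
  have himg : Set.image (fun g : SL2 k => (g.1 : Matrix (Fin 2) (Fin 2) k))
      (matGen {BinIco.mD ζ₁₀, BinIco.mW, BinIco.mT c a} : Subgroup (SL2 k))
      = Set.range (BinIco.par c a) := by
    ext M
    rw [BinIco.mem_range_par]
    constructor
    · rintro ⟨g, hg, rfl⟩
      exact BinIco.Mem_of_mem hζ₁₀ hζ₅ hc ha g hg
    · intro hM
      exact BinIco.exists_mem_of_Mem hζ₁₀ (BinIco.csq hζ₅ hc ha) hM
  have hcard : Nat.card (matGen {BinIco.mD ζ₁₀, BinIco.mW, BinIco.mT c a}) = 120 := by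
    rw [← BinIco.ncard_range_par hζ₁₀ hζ₅ hc0 ha0 haa, ← himg,
      Set.ncard_image_of_injective (f := fun g : SL2 k => (g.1 : Matrix (Fin 2) (Fin 2) k)) _
        (fun g h e => Subtype.ext e)]
    exact Nat.card_coe_set_eq _
  exact ⟨Nat.finite_of_card_ne_zero (by rw [hcard]; norm_num), hcard⟩
end

section
/- Let k be a field, r ≥ 3 an integer, A = k[T]/(T^r − 1), and let ζ denote the image of T in A (so ζ is invertible with ζ^{-1} = ζ^{r−1}). Suppose a, b, c, d ∈ k satisfy ad − bc = 1, and λ, μ ∈ A are such that, in the ring of 2×2 matrices over A, [[a, b],[c, d]] · diag(ζ, ζ^{-1}) = diag(λ, μ) · [[a, b],[c, d]] (where a, b, c, d are regarded as elements of A via the structure map k → A). Then either (λ = ζ, μ = ζ^{-1}, and b = c = 0) or (λ = ζ^{-1}, μ = ζ, and a = d = 0). -/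
open Polynomial

theorem zeta_aux (k : Type*) [Field k] (r : ℕ) (hr : 3 ≤ r) (x : k)
    (h : (Ideal.Quotient.mk (Ideal.span {(X : k[X]) ^ r - 1})) (C x * (X - X ^ (r - 1))) = 0) :
    x = 0 := by
  rw [Ideal.Quotient.eq_zero_iff_mem, Ideal.mem_span_singleton] at h
  have hm : ((X : k[X]) ^ r - 1).natDegree = r := by
    simpa using natDegree_X_pow_sub_C (R := k) (n := r) (r := 1)
  have h0 : C x * (X - X ^ (r - 1)) = 0 := by
    refine eq_zero_of_dvd_of_natDegree_lt h ?_
    rw [hm]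
    have h2 : (C x * (X - X ^ (r - 1)) : k[X]).natDegree ≤ r - 1 := by
      refine (natDegree_C_mul_le _ _).trans ((natDegree_sub_le _ _).trans ?_)
      simp
      omega
    omega
  have := congrArg (fun p => coeff p 1) h0
  simpa [coeff_X_pow, show 1 ≠ r - 1 by omega] using this

/-- in `A = k[T]/(Tʳ - 1)` with `r ≥ 3` and `ζ` the image of `T`, if
`a, b, c, d ∈ k` with `ad - bc = 1` and `λ, μ ∈ A` satisfy
`[[a,b],[c,d]] ⬝ diag(ζ, ζ⁻¹) = diag(λ, μ) ⬝ [[a,b],[c,d]]` over `A` (with `ζ⁻¹ = ζ^(r-1)`),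
then either `λ = ζ`, `μ = ζ^(r-1)` and `b = c = 0`, or `λ = ζ^(r-1)`, `μ = ζ` and
`a = d = 0`. -/
theorem diagonal_commutation (k : Type*) [Field k] (r : ℕ) (hr : 3 ≤ r)
    (a b c d : k) (h1 : a * d - b * c = 1)
    (lam mu : k[X] ⧸ Ideal.span {(X : k[X]) ^ r - 1}) :
    letI A := k[X] ⧸ Ideal.span {(X : k[X]) ^ r - 1}
    letI ζ : A := Ideal.Quotient.mk _ (X : k[X])
    letI f : k →+* A := (Ideal.Quotient.mk _).comp Polynomial.C
    (!![f a, f b; f c, f d] * !![ζ, 0; 0, ζ ^ (r - 1)]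
      = !![lam, 0; 0, mu] * !![f a, f b; f c, f d]) →
    ((lam = ζ ∧ mu = ζ ^ (r - 1) ∧ b = 0 ∧ c = 0) ∨
     (lam = ζ ^ (r - 1) ∧ mu = ζ ∧ a = 0 ∧ d = 0)) := by
  intro h
  have e00 := congrFun (congrFun h 0) 0
  have e01 := congrFun (congrFun h 0) 1
  have e10 := congrFun (congrFun h 1) 0
  have e11 := congrFun (congrFun h 1) 1
  simp [Matrix.mul_apply, Fin.sum_univ_two] at e00 e01 e10 e11
  set q := Ideal.Quotient.mk (Ideal.span {(X : k[X]) ^ r - 1}) with hq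
  have hab : a * b = 0 := by
    apply zeta_aux k r hr
    rw [← hq]
    simp only [map_mul, map_sub, map_pow]
    linear_combination q (C b) * e00 - q (C a) * e01
  have hcd : c * d = 0 := by
    apply zeta_aux k r hr
    rw [← hq]
    simp only [map_mul, map_sub, map_pow]
    linear_combination q (C d) * e10 - q (C c) * e11
  have hC : ∀ x y : k, x * y = 1 → q (C x) * q (C y) = 1 := by
    intro x y hxy
    rw [← map_mul, ← C_mul, hxy]
    simp
  rcases mul_eq_zero.mp hab with ha | hb
  · right
    subst ha
    have hbc : c * (-b) = 1 := by linear_combination h1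
    have hc : c ≠ 0 := by rintro rfl; simp at hbc
    have hd : d = 0 := (mul_eq_zero.mp hcd).resolve_left hc
    have hu := hC _ _ hbc
    simp only [map_neg] at hu
    refine ⟨?_, ?_, rfl, hd⟩
    · linear_combination (q X ^ (r - 1) - lam) * hu + q (C c) * e01
    · linear_combination (q X - mu) * hu + q (C b) * e10
  · left
    subst hb
    have had : a * d = 1 := by linear_combination h1
    have hd : d ≠ 0 := by rintro rfl; simp at had
    have hc : c = 0 := (mul_eq_zero.mp hcd).resolve_right hd
    have hu := hC _ _ had
    refine ⟨?_, ?_, rfl, hc⟩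
    · linear_combination (q X - lam) * hu - q (C d) * e00
    · linear_combination (q X ^ (r - 1) - mu) * hu - q (C a) * e11
end

section
/- Let k be a field and n ≥ 1. Let φ : k[X, Y, Z] → k[u, v] be the k-algebra homomorphism determined by φ(X) = u^{n+1}, φ(Y) = −v^{n+1}, φ(Z) = uv. Then the kernel of φ is the principal ideal generated by XY + Z^{n+1}, and the image of φ is the degree-0 component of the Z/(n+1)Z-grading on k[u,v] with deg u = 1, deg v = −1. Consequently k[X,Y,Z]/(XY + Z^{n+1}) is isomorphic as a k-algebra to that degree-0 subalgebra. -/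
open MvPolynomial

/-- normal form section on monomials -/
noncomputable def secMon (k : Type*) [Field k] (n : ℕ) (m : Fin 2 →₀ ℕ) : MvPolynomial (Fin 3) k :=
  X 0 ^ ((m 0 - m 1) / (n + 1)) * (-X 1) ^ ((m 1 - m 0) / (n + 1)) * X 2 ^ (min (m 0) (m 1))

/-- linear section -/
noncomputable def secLin (k : Type*) [Field k] (n : ℕ) :
    MvPolynomial (Fin 2) k →ₗ[k] MvPolynomial (Fin 3) k :=
  (basisMonomials (Fin 2) k).constr k (secMon k n)

/-- the map -/
noncomputable def phiA (k : Type*) [Field k] (n : ℕ) :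
    MvPolynomial (Fin 3) k →ₐ[k] MvPolynomial (Fin 2) k :=
  aeval ![(X 0 : MvPolynomial (Fin 2) k) ^ (n + 1), -(X 1 : MvPolynomial (Fin 2) k) ^ (n + 1),
        (X 0 : MvPolynomial (Fin 2) k) * X 1]

theorem phiA_X0 (k : Type*) [Field k] (n : ℕ) : phiA k n (X 0) = X 0 ^ (n + 1) := by
  simp [phiA]
theorem phiA_X1 (k : Type*) [Field k] (n : ℕ) : phiA k n (X 1) = -X 1 ^ (n + 1) := by
  simp [phiA]
theorem phiA_X2 (k : Type*) [Field k] (n : ℕ) : phiA k n (X 2) = X 0 * X 1 := by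
  simp [phiA]

/-- exponent in two variables -/
noncomputable def expo (a b : ℕ) : Fin 2 →₀ ℕ := Finsupp.single 0 a + Finsupp.single 1 b

theorem expo_zero (a b : ℕ) : expo a b 0 = a := by simp [expo]
theorem expo_one (a b : ℕ) : expo a b 1 = b := by simp [expo]

theorem monomial_two (k : Type*) [Field k] (m : Fin 2 →₀ ℕ) (c : k) :
    monomial m c = C c * (X 0 ^ m 0 * X 1 ^ m 1) := by
  rw [monomial_eq, Finsupp.prod_fintype _ _ (by simp)]
  simp [Fin.prod_univ_two]

theorem monomial_three (k : Type*) [Field k] (m : Fin 3 →₀ ℕ) (c : k) :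
    monomial m c = C c * (X 0 ^ m 0 * X 1 ^ m 1 * X 2 ^ m 2) := by
  rw [monomial_eq, Finsupp.prod_fintype _ _ (by simp)]
  simp [Fin.prod_univ_three]

theorem secLin_monomial (k : Type*) [Field k] (n : ℕ) (m : Fin 2 →₀ ℕ) (c : k) :
    secLin k n (monomial m c) = C c * secMon k n m := by
  have h : (monomial m c : MvPolynomial (Fin 2) k) = c • basisMonomials (Fin 2) k m := by
    simp [coe_basisMonomials, smul_monomial]
  rw [h, map_smul, secLin, Module.Basis.constr_basis, smul_eq_C_mul]

theorem phiA_monomial (k : Type*) [Field k] (n : ℕ) (m : Fin 3 →₀ ℕ) (c : k) :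
    phiA k n (monomial m c) =
      monomial (expo ((n + 1) * m 0 + m 2) ((n + 1) * m 1 + m 2)) (c * (-1) ^ m 1) := by
  rw [monomial_three, monomial_two, expo_zero, expo_one]
  have hC : phiA k n (C c) = C c := (phiA k n).commutes c
  simp only [map_mul, map_pow, phiA_X0, phiA_X1, phiA_X2, hC, map_neg, map_one]
  rw [neg_pow]
  ring

theorem phiA_secMon (k : Type*) [Field k] (n : ℕ) (m : Fin 2 →₀ ℕ)
    (h : m 0 ≡ m 1 [MOD n + 1]) (c : k) :
    phiA k n (C c * secMon k n m) = monomial m c := by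
  have hC : phiA k n (C c) = C c := (phiA k n).commutes c
  rw [monomial_two]
  simp only [secMon, map_mul, map_pow, map_neg, phiA_X0, phiA_X1, phiA_X2, hC, neg_neg]
  congr 1
  rw [← pow_mul, ← pow_mul, mul_pow]
  rcases le_total (m 0) (m 1) with hl | hl
  · have hd := (Nat.modEq_iff_dvd' hl).1 h
    rw [Nat.mul_div_cancel' hd, min_eq_left hl, Nat.sub_eq_zero_of_le hl]
    obtain ⟨d, hd⟩ := Nat.exists_eq_add_of_le hl
    rw [hd]; simp; ring
  · have hd := (Nat.modEq_iff_dvd' hl).1 h.symm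
    rw [Nat.mul_div_cancel' hd, min_eq_right hl, Nat.sub_eq_zero_of_le hl]
    obtain ⟨d, hd⟩ := Nat.exists_eq_add_of_le hl
    rw [hd]; simp; ring

theorem sec_phiA (k : Type*) [Field k] (n : ℕ) (p : MvPolynomial (Fin 3) k) :
    p - secLin k n (phiA k n p) ∈ Ideal.span
      {(X 0 : MvPolynomial (Fin 3) k) * X 1 + (X 2 : MvPolynomial (Fin 3) k) ^ (n + 1)} := by
  induction p using MvPolynomial.induction_on' with
  | add p q hp hq =>
    have := Ideal.add_mem _ hp hq
    rw [map_add, map_add]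
    convert this using 1
    ring
  | monomial m c =>
    rw [phiA_monomial, secLin_monomial, secMon, expo_zero, expo_one, monomial_three,
      Ideal.mem_span_singleton]
    have key : ∀ j : ℕ, ((X 0 : MvPolynomial (Fin 3) k) * X 1 + X 2 ^ (n + 1)) ∣
        (X 0 * X 1) ^ j - (-X 2 ^ (n + 1)) ^ j := fun j => by
      have := sub_dvd_pow_sub_pow ((X 0 : MvPolynomial (Fin 3) k) * X 1) (-X 2 ^ (n + 1)) j
      rwa [sub_neg_eq_add] at this
    rcases le_total (m 0) (m 1) with hl | hl
    · obtain ⟨d, hd⟩ := Nat.exists_eq_add_of_le hl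
      rw [hd]
      have e1 : (n + 1) * m 0 + m 2 - ((n + 1) * (m 0 + d) + m 2) = 0 := by
        rw [mul_add]; omega
      have e2 : (n + 1) * (m 0 + d) + m 2 - ((n + 1) * m 0 + m 2) = (n + 1) * d := by
        rw [mul_add]; omega
      have e3 : min ((n + 1) * m 0 + m 2) ((n + 1) * (m 0 + d) + m 2) = (n + 1) * m 0 + m 2 := by
        rw [mul_add]; omega
      rw [e1, e2, e3, Nat.mul_div_cancel_left _ (Nat.succ_pos n)]
      obtain ⟨w, hw⟩ := key (m 0)
      have hs : ((-1 : MvPolynomial (Fin 3) k) ^ d) * (-1) ^ d = 1 := by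
        rw [← mul_pow]; simp
      refine ⟨C c * X 1 ^ d * X 2 ^ m 2 * w, ?_⟩
      simp only [map_mul, map_pow, map_neg, map_one, Nat.zero_div, pow_zero, one_mul]
      rw [neg_pow (X 1 : MvPolynomial (Fin 3) k)]
      rw [neg_pow ((X 2 : MvPolynomial (Fin 3) k) ^ (n + 1))] at hw
      linear_combination (C c * X 1 ^ d * X 2 ^ m 2) * hw -
        (C c * X 1 ^ d * X 2 ^ m 2 * (-1) ^ m 0 * (X 2 ^ (n + 1)) ^ m 0) * hs
    · obtain ⟨d, hd⟩ := Nat.exists_eq_add_of_le hl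
      rw [hd]
      have e1 : (n + 1) * m 1 + m 2 - ((n + 1) * (m 1 + d) + m 2) = 0 := by
        rw [mul_add]; omega
      have e2 : (n + 1) * (m 1 + d) + m 2 - ((n + 1) * m 1 + m 2) = (n + 1) * d := by
        rw [mul_add]; omega
      have e3 : min ((n + 1) * (m 1 + d) + m 2) ((n + 1) * m 1 + m 2) = (n + 1) * m 1 + m 2 := by
        rw [mul_add]; omega
      rw [e1, e2, e3, Nat.mul_div_cancel_left _ (Nat.succ_pos n)]
      obtain ⟨w, hw⟩ := key (m 1)
      refine ⟨C c * X 0 ^ d * X 2 ^ m 2 * w, ?_⟩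
      simp only [map_mul, map_pow, map_neg, map_one, Nat.zero_div, pow_zero, mul_one]
      rw [neg_pow ((X 2 : MvPolynomial (Fin 3) k) ^ (n + 1))] at hw
      linear_combination (C c * X 0 ^ d * X 2 ^ m 2) * hw

theorem phiA_ker (k : Type*) [Field k] (n : ℕ) :
    RingHom.ker (phiA k n : MvPolynomial (Fin 3) k →+* MvPolynomial (Fin 2) k) = Ideal.span
      {(X 0 : MvPolynomial (Fin 3) k) * X 1 + (X 2 : MvPolynomial (Fin 3) k) ^ (n + 1)} := by
  apply le_antisymm
  · intro p hp
    have h0 : phiA k n p = 0 := hp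
    have := sec_phiA k n p
    rwa [h0, map_zero, sub_zero] at this
  · rw [Ideal.span_le, Set.singleton_subset_iff]
    change phiA k n _ = 0
    simp only [map_add, map_mul, map_pow, phiA_X0, phiA_X1, phiA_X2]
    ring

theorem phiA_range (k : Type*) [Field k] (n : ℕ) :
    ((phiA k n).range : Set (MvPolynomial (Fin 2) k))
        = {f : MvPolynomial (Fin 2) k | ∀ m ∈ f.support, m 0 ≡ m 1 [MOD n + 1]} := by
  ext f
  constructor
  · rintro ⟨p, rfl⟩
    change ∀ m ∈ (phiA k n p).support, m 0 ≡ m 1 [MOD n + 1]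
    induction p using MvPolynomial.induction_on' with
    | add p q hp hq =>
      intro m hm
      rw [map_add] at hm
      rcases Finset.mem_union.1 (support_add hm) with h | h
      · exact hp m h
      · exact hq m h
    | monomial s c =>
      intro m hm
      rw [phiA_monomial] at hm
      have := Finset.mem_singleton.1 (support_monomial_subset hm)
      rw [this, expo_zero, expo_one]
      simp [Nat.ModEq, Nat.mul_add_mod]
  · intro hf
    rw [f.as_sum]
    refine Subalgebra.sum_mem _ fun m hm => ?_
    exact ⟨_, phiA_secMon k n m (hf m hm) _⟩

/-- for the `k`-algebra map `φ : k[X,Y,Z] → k[u,v]` with `φ(X) = u^(n+1)`,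
`φ(Y) = -v^(n+1)`, `φ(Z) = uv`, the kernel of `φ` is the principal ideal
`(XY + Z^(n+1))`, the image of `φ` is the degree-0 component of the `ℤ/(n+1)ℤ`-grading on
`k[u,v]` with `deg u = 1`, `deg v = -1`, and consequently
`k[X,Y,Z]/(XY + Z^(n+1))` is `k`-isomorphic to that degree-0 subalgebra. -/
theorem kernel_and_image_typeA (k : Type*) [Field k] (n : ℕ) (hn : 1 ≤ n) :
    letI φ : MvPolynomial (Fin 3) k →ₐ[k] MvPolynomial (Fin 2) k :=
      aeval ![(X 0 : MvPolynomial (Fin 2) k) ^ (n + 1), -(X 1 : MvPolynomial (Fin 2) k) ^ (n + 1),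
        (X 0 : MvPolynomial (Fin 2) k) * X 1]
    RingHom.ker (φ : MvPolynomial (Fin 3) k →+* MvPolynomial (Fin 2) k)
        = Ideal.span {(X 0 : MvPolynomial (Fin 3) k) * X 1 + (X 2 : MvPolynomial (Fin 3) k) ^ (n + 1)} ∧
      (φ.range : Set (MvPolynomial (Fin 2) k))
        = {f : MvPolynomial (Fin 2) k | ∀ m ∈ f.support, m 0 ≡ m 1 [MOD n + 1]} ∧
      Nonempty ((MvPolynomial (Fin 3) k ⧸ Ideal.span
          {(X 0 : MvPolynomial (Fin 3) k) * X 1 + (X 2 : MvPolynomial (Fin 3) k) ^ (n + 1)})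
        ≃ₐ[k] φ.range) := by
  refine ⟨phiA_ker k n, phiA_range k n, ⟨?_⟩⟩
  exact (Ideal.quotientEquivAlgOfEq k (phiA_ker k n).symm).trans
    (Ideal.quotientKerEquivRange (phiA k n))
end

section
/- Let k be a field and n ≥ 1. Then the quotient ring R_1 = k[X, Y, Z]/(XY + Z^{n+1}) is an integral domain, is integrally closed in its field of fractions (i.e., is a normal domain), and has Krull dimension 2. -/
open MvPolynomial

/-- A retract of an integrally closed domain is integrally closed. -/
theorem integrallyClosed_of_retract {R A : Type*} [CommRing R] [CommRing A] [IsDomain R]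
    [IsDomain A] [IsIntegrallyClosed A] (φ : R →+* A) (ψ : A → R)
    (hψ : ∀ r a, ψ (φ r * a) = r * ψ a) (h1 : ψ 1 = 1) : IsIntegrallyClosed R := by
  have hψφ : ∀ r, ψ (φ r) = r := fun r => by simpa [h1] using hψ r 1
  have hinj : Function.Injective φ := Function.LeftInverse.injective hψφ
  rw [isIntegrallyClosed_iff (FractionRing R)]
  intro x hx
  obtain ⟨f, g, hg, rfl⟩ := IsFractionRing.div_surjective (A := R) x
  have hg0 : g ≠ 0 := nonZeroDivisors.ne_zero hg
  have hφg : φ g ≠ 0 := fun h => hg0 (hinj (by simpa using h))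
  have hinj' : Function.Injective ((algebraMap A (FractionRing A)).comp φ) :=
    (IsFractionRing.injective A (FractionRing A)).comp hinj
  let Φ : FractionRing R →+* FractionRing A := IsFractionRing.lift hinj'
  have hΦ : ∀ r, Φ (algebraMap R _ r) = algebraMap A _ (φ r) := fun r =>
    IsFractionRing.lift_algebraMap hinj' r
  have hint : IsIntegral A (Φ (algebraMap R _ f / algebraMap R _ g)) := by
    obtain ⟨p, hp, hpe⟩ := hx
    refine ⟨p.map φ, hp.map φ, ?_⟩
    rw [Polynomial.eval₂_map]
    have := congrArg Φ hpe
    rw [Polynomial.hom_eval₂, map_zero] at this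
    rw [← this]
    congr 1
    ext r
    exact (hΦ r).symm
  obtain ⟨h, hh⟩ := (isIntegrallyClosed_iff (FractionRing A)).1 inferInstance hint
  rw [map_div₀, hΦ, hΦ, eq_div_iff (by simpa using hφg), ← map_mul] at hh
  have hh' := IsFractionRing.injective A (FractionRing A) hh
  refine ⟨ψ h, ?_⟩
  rw [eq_div_iff (by simpa using hg0), ← map_mul]
  congr 1
  rw [← hψφ f, ← hh', mul_comm h, hψ, mul_comm]

theorem typeA_retract (k : Type*) [Field k] (n : ℕ) {R : Type*} [CommRing R] [Algebra k R]
    (x y z : R) (hxyz : x * y + z ^ (n + 1) = 0) :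
    ∃ ψ : MvPolynomial (Fin 2) k →ₗ[k] R, ψ 1 = 1 ∧
      (∀ p, ψ (X 0 ^ (n + 1) * p) = x * ψ p) ∧ (∀ p, ψ (-(X 1 ^ (n + 1)) * p) = y * ψ p) ∧
      (∀ p, ψ (X 0 * X 1 * p) = z * ψ p) := by
  let F : (Fin 2 →₀ ℕ) → R := fun m =>
    if m 0 % (n + 1) = m 1 % (n + 1) then
      x ^ (m 0 / (n + 1)) * (-y) ^ (m 1 / (n + 1)) * z ^ (m 0 % (n + 1)) else 0
  let ψ : MvPolynomial (Fin 2) k →ₗ[k] R := (basisMonomials (Fin 2) k).constr k F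
  have hψ : ∀ m, ψ (monomial m 1) = F m := fun m => by
    have := (basisMonomials (Fin 2) k).constr_basis k F m
    simpa using this
  have key : ∀ (q : MvPolynomial (Fin 2) k) (r : R),
      (∀ m, ψ (q * monomial m 1) = r * F m) → ∀ p, ψ (q * p) = r * ψ p := by
    intro q r h p
    have : ψ ∘ₗ LinearMap.mulLeft k q = LinearMap.mulLeft k r ∘ₗ ψ := by
      apply (basisMonomials (Fin 2) k).ext
      intro m
      simp [h, hψ]
    exact LinearMap.congr_fun this p
  have hX : ∀ (i : Fin 2) (e : ℕ), (X i ^ e : MvPolynomial (Fin 2) k) =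
      monomial (Finsupp.single i e) 1 := fun i e => X_pow_eq_monomial
  have hx0 : (n + 1) ≠ 0 := by omega
  refine ⟨ψ, ?_, key _ _ ?_, ?_, key _ _ ?_⟩
  · have := hψ 0
    simpa [F] using this
  · intro m
    rw [hX, monomial_mul, one_mul, hψ]
    simp only [F, Finsupp.add_apply]
    simp [Nat.add_div_left, pow_succ]
    ring_nf
  · intro p
    have := key (X 1 ^ (n + 1)) (-y) ?_ p
    · simp [this]
    intro m
    rw [hX, monomial_mul, one_mul, hψ]
    simp only [F, Finsupp.add_apply]
    simp [Nat.add_div_left, pow_succ]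
    ring_nf
  · intro m
    have h2 : (X 0 * X 1 : MvPolynomial (Fin 2) k) =
      monomial (Finsupp.single 0 1 + Finsupp.single 1 1) 1 := by
      rw [← pow_one (X 0), ← pow_one (X 1), hX, hX, monomial_mul, one_mul]
    rw [h2, monomial_mul, one_mul, hψ]
    have e0 : (Finsupp.single 0 1 + Finsupp.single 1 1 + m : Fin 2 →₀ ℕ) 0 = m 0 + 1 := by
      simp [add_comm]
    have e1 : (Finsupp.single 0 1 + Finsupp.single 1 1 + m : Fin 2 →₀ ℕ) 1 = m 1 + 1 := by
      simp [add_comm]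
    simp only [F, e0, e1]
    generalize m 0 = a
    generalize m 1 = b
    have hiff : (a + 1) % (n + 1) = (b + 1) % (n + 1) ↔ a % (n + 1) = b % (n + 1) :=
      ⟨fun h => Nat.ModEq.add_right_cancel' 1 h, fun h => Nat.ModEq.add_right 1 h⟩
    by_cases hab : a % (n + 1) = b % (n + 1)
    · rw [if_pos (hiff.2 hab), if_pos hab]
      by_cases hl : a % (n + 1) = n
      · have step : ∀ c, c % (n + 1) = n →
            (c + 1) / (n + 1) = c / (n + 1) + 1 ∧ (c + 1) % (n + 1) = 0 := by
          intro c hc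
          have hc' : c + 1 = (n + 1) * (c / (n + 1) + 1) := by
            have := Nat.div_add_mod c (n + 1)
            rw [mul_add]
            omega
          constructor
          · rw [hc', Nat.mul_div_cancel_left _ (by omega)]
          · rw [hc', Nat.mul_mod_right]
        rw [(step a hl).1, (step b (hab ▸ hl)).1, (step a hl).2, hl]
        linear_combination (- x ^ (a / (n + 1)) * (-y) ^ (b / (n + 1))) * hxyz
      · have step : ∀ c, c % (n + 1) ≠ n →
            (c + 1) / (n + 1) = c / (n + 1) ∧ (c + 1) % (n + 1) = c % (n + 1) + 1 := by
          intro c hc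
          have hlt : c % (n + 1) < n + 1 := Nat.mod_lt _ (by omega)
          have hc' : c + 1 = (c % (n + 1) + 1) + (n + 1) * (c / (n + 1)) := by
            have := Nat.div_add_mod c (n + 1)
            omega
          have hlt' : c % (n + 1) + 1 < n + 1 := by omega
          constructor
          · conv_lhs => rw [hc']
            rw [Nat.add_mul_div_left _ _ (by omega), Nat.div_eq_of_lt hlt', zero_add]
          · conv_lhs => rw [hc']
            rw [Nat.add_mul_mod_self_left, Nat.mod_eq_of_lt hlt']
        rw [(step a hl).1, (step b (hab ▸ hl)).1, (step a hl).2]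
        ring
    · rw [if_neg (fun h => hab (hiff.1 h)), if_neg hab, mul_zero]

/-- `R₁ = k[X,Y,Z]/(XY + Z^(n+1))` is a normal domain of Krull dimension 2. -/
theorem typeA_singularity_normal_domain_dim_two (k : Type*) [Field k] (n : ℕ) (hn : 1 ≤ n) :
    letI R₁ := MvPolynomial (Fin 3) k ⧸ Ideal.span
      {(X 0 : MvPolynomial (Fin 3) k) * X 1 + (X 2 : MvPolynomial (Fin 3) k) ^ (n + 1)}
    IsDomain R₁ ∧ IsIntegrallyClosed R₁ ∧ ringKrullDim R₁ = 2 := by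
  set I : Ideal (MvPolynomial (Fin 3) k) := Ideal.span
      {(X 0 : MvPolynomial (Fin 3) k) * X 1 + (X 2 : MvPolynomial (Fin 3) k) ^ (n + 1)} with hI
  let q : MvPolynomial (Fin 3) k →ₐ[k] MvPolynomial (Fin 3) k ⧸ I := Ideal.Quotient.mkₐ k I
  have hrel : q (X 0) * q (X 1) + q (X 2) ^ (n + 1) = 0 := by
    rw [← map_mul, ← map_pow, ← map_add]
    exact Ideal.Quotient.eq_zero_iff_mem.2 (Ideal.subset_span rfl)
  obtain ⟨ψ, h1, hx, hy, hz⟩ := typeA_retract k n _ _ _ hrel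
  have lift : ∀ {B : Type _} [CommRing B] [Algebra k B] (v : Fin 3 → B),
      v 0 * v 1 + v 2 ^ (n + 1) = 0 →
      ∃ φ : (MvPolynomial (Fin 3) k ⧸ I) →ₐ[k] B, ∀ p, φ (q p) = aeval v p := by
    intro B _ _ v hv
    refine ⟨Ideal.Quotient.liftₐ I (aeval v) ?_, fun p => rfl⟩
    intro a ha
    have : I ≤ RingHom.ker (aeval v : MvPolynomial (Fin 3) k →ₐ[k] B) := by
      rw [hI, Ideal.span_singleton_le_iff_mem, RingHom.mem_ker]
      simpa using hv
    exact this ha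
  obtain ⟨φ, hφ⟩ := lift (B := MvPolynomial (Fin 2) k)
    ![X 0 ^ (n + 1), -(X 1 ^ (n + 1)), X 0 * X 1] (by simp; ring)
  have hlin : ∀ r a, ψ (φ r * a) = r * ψ a := by
    intro r
    obtain ⟨p, rfl⟩ : ∃ p, q p = r := Ideal.Quotient.mk_surjective r
    induction p using MvPolynomial.induction_on with
    | C c =>
      intro a
      rw [hφ, algHom_C, ← Algebra.smul_def, map_smul]
      exact Algebra.smul_def c (ψ a)
    | add p p' h h' =>
      intro a
      rw [map_add, map_add, add_mul, map_add, h, h', add_mul]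
    | mul_X p i h =>
      intro a
      rw [map_mul q, map_mul φ, mul_assoc, h, mul_assoc]
      congr 1
      rw [hφ (X i), aeval_X]
      fin_cases i
      · exact hx a
      · exact hy a
      · exact hz a
  have hinj : Function.Injective φ := Function.LeftInverse.injective (g := ψ)
    (fun r => by simpa [h1] using hlin r 1)
  have hdom : IsDomain (MvPolynomial (Fin 3) k ⧸ I) := hinj.isDomain φ
  refine ⟨hdom, integrallyClosed_of_retract φ.toRingHom ψ hlin h1, le_antisymm ?_ ?_⟩
  · have hne : ((X 0 : MvPolynomial (Fin 3) k) * X 1 + X 2 ^ (n + 1)) ≠ 0 := by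
      intro h
      have := congrArg (aeval (![1, 1, 0] : Fin 3 → k)) h
      simp at this
    have h3 := ringKrullDim_quotient_succ_le_of_nonZeroDivisor (mem_nonZeroDivisors_of_ne_zero hne)
    rw [MvPolynomial.ringKrullDim_of_isNoetherianRing, ringKrullDim_eq_zero_of_field] at h3
    have h4 : ringKrullDim (MvPolynomial (Fin 3) k ⧸ I) + 1 ≤ 2 + 1 := by
      refine h3.trans (le_of_eq ?_)
      simp
      norm_num
    exact (ENat.WithBot.add_le_add_one_right_iff).1 h4
  · obtain ⟨θ, hθ⟩ := lift (B := Polynomial k) ![Polynomial.X, 0, 0] (by simp)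
    have hsurj : Function.Surjective θ := by
      intro p
      refine ⟨q (Polynomial.aeval (X 0) p), ?_⟩
      rw [hθ, ← Polynomial.aeval_algHom_apply]
      simp
    have hy0 : q (X 1) ≠ 0 := by
      intro h
      have := congrArg φ h
      rw [hφ] at this
      simp at this
    have h3 := ringKrullDim_succ_le_of_surjective θ.toRingHom hsurj
      (mem_nonZeroDivisors_of_ne_zero hy0) (by
        change θ (q (X 1)) = 0
        rw [hθ]; simp)
    rw [Polynomial.ringKrullDim_of_isNoetherianRing, ringKrullDim_eq_zero_of_field] at h3
    refine le_trans (le_of_eq ?_) h3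
    norm_num
end

section
/- Let k be an algebraically closed field of characteristic different from 2, and let n ≥ 4. Then the quotient ring R_1 = k[X, Y, Z]/(X² + Y Z² + Y^{n−1}) is an integral domain, is integrally closed in its field of fractions (i.e., is a normal domain), and has Krull dimension 2. -/
open MvPolynomial

lemma quad_coord1 {K : Type*} [CommRing K] (δ a b : K) :
    (⟨a, 0⟩ + ⟨b, 0⟩ * QuadraticAlgebra.omega : QuadraticAlgebra K δ 0) = ⟨a, b⟩ := by
  ext <;> simp

lemma quad_coord2 {K : Type*} [CommRing K] (δ a : K) :
    star (⟨a, 0⟩ : QuadraticAlgebra K δ 0) = ⟨a, 0⟩ := by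
  ext <;> simp

lemma quad_coord3 {K : Type*} [CommRing K] (δ : K) (u : QuadraticAlgebra K δ 0) :
    algebraMap K (QuadraticAlgebra K δ 0) (2 * u.re) = u + star u := by
  rw [QuadraticAlgebra.algebraMap_eq]
  ext <;> simp [two_mul]

lemma quad_coord4 {K : Type*} [CommRing K] (δ : K) (u : QuadraticAlgebra K δ 0) :
    algebraMap K (QuadraticAlgebra K δ 0) (u.im ^ 2 * δ) = (u - ⟨u.re, 0⟩) ^ 2 := by
  rw [QuadraticAlgebra.algebraMap_eq, pow_two (u - _)]
  ext
  · simp; ring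
  · simp

lemma quad_normal_aux (A : Type*) [CommRing A] [IsDomain A] [UniqueFactorizationMonoid A]
    (h2 : IsUnit (2 : A)) (d : A) (hd : Squarefree d) (hu : ¬ IsUnit d) :
    IsDomain (Polynomial A ⧸ Ideal.span {(Polynomial.X ^ 2 - Polynomial.C d : Polynomial A)}) ∧
    IsIntegrallyClosed
      (Polynomial A ⧸ Ideal.span {(Polynomial.X ^ 2 - Polynomial.C d : Polynomial A)}) := by
  classical
  let K := FractionRing A
  have hinj : Function.Injective (algebraMap A K) := IsFractionRing.injective A K
  have hns : ∀ r : K, r ^ 2 ≠ algebraMap A K d + 0 * r := by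
    intro r hr
    rw [zero_mul, add_zero] at hr
    have hi : IsIntegral A r := IsIntegral.of_pow (n := 2) (by norm_num) (hr ▸ isIntegral_algebraMap)
    obtain ⟨a, rfl⟩ := IsIntegrallyClosed.isIntegral_iff.mp hi
    rw [← map_pow] at hr
    have := hinj hr
    have h1 := hd a ⟨1, by rw [← this]; ring⟩
    exact hu (this ▸ h1.pow 2)
  have : Fact (∀ r : K, r ^ 2 ≠ algebraMap A K d + 0 * r) := ⟨hns⟩
  let L := QuadraticAlgebra K (algebraMap A K d) 0
  let w : L := QuadraticAlgebra.omega
  have halg : ∀ a : A, algebraMap A L a = ⟨algebraMap A K a, 0⟩ := fun a => rfl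
  have hww : w ^ 2 = algebraMap A L d := by
    rw [pow_two, halg]; exact QuadraticAlgebra.omega_mul_omega_eq_mk
  have hwi : IsIntegral A w := IsIntegral.of_pow (n := 2) (by norm_num) (hww ▸ isIntegral_algebraMap)
  have hab : ∀ a b : A, algebraMap A L a + algebraMap A L b * w
      = ⟨algebraMap A K a, algebraMap A K b⟩ := by
    intro a b
    rw [halg, halg]
    exact quad_coord1 _ _ _
  let φ : Polynomial A →ₐ[A] L := Polynomial.aeval w
  have hker : ∀ p, φ p = 0 → p ∈ Ideal.span {(Polynomial.X ^ 2 - Polynomial.C d : Polynomial A)} := by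
    intro p hp
    have hm : (Polynomial.X ^ 2 - Polynomial.C d : Polynomial A).Monic :=
      Polynomial.monic_X_pow_sub_C d (by norm_num)
    set q := (Polynomial.X ^ 2 - Polynomial.C d : Polynomial A) with hq
    have hdiv := Polynomial.modByMonic_add_div p q
    have hφq : φ q = 0 := by simp [φ, hq, hww]
    have hdeg : (p %ₘ q).degree ≤ 1 := by
      have h1 := Polynomial.degree_modByMonic_lt p hm
      rw [hq, Polynomial.degree_X_pow_sub_C (by norm_num)] at h1
      exact Order.le_of_lt_succ h1
    have hr := Polynomial.eq_X_add_C_of_degree_le_one hdeg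
    have hφr : φ (p %ₘ q) = 0 := by
      have := congrArg φ hdiv
      rw [map_add, map_mul, hφq, zero_mul, add_zero, hp] at this
      exact this
    rw [hr] at hφr
    have h3 : algebraMap A L ((p %ₘ q).coeff 0) + algebraMap A L ((p %ₘ q).coeff 1) * w = 0 := by
      rw [← hφr]; simp [φ, add_comm]
    rw [hab] at h3
    have h4 := congrArg QuadraticAlgebra.re h3
    have h5 := congrArg QuadraticAlgebra.im h3
    simp only [QuadraticAlgebra.re_zero, QuadraticAlgebra.im_zero] at h4 h5
    rw [← map_zero (algebraMap A K)] at h4 h5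
    have h4' := hinj h4
    have h5' := hinj h5
    rw [h4', h5'] at hr
    simp at hr
    rw [Ideal.mem_span_singleton]
    rw [hr, zero_add] at hdiv
    exact ⟨_, hdiv.symm⟩
  have hmem : ∀ p, φ p ∈ integralClosure A L := by
    intro p
    have : φ p ∈ Algebra.adjoin A {w} := Polynomial.aeval_mem_adjoin_singleton A w
    exact (Algebra.adjoin_le (Set.singleton_subset_iff.mpr hwi) : Algebra.adjoin A {w} ≤ integralClosure A L) this
  let ψ : Polynomial A →ₐ[A] integralClosure A L := φ.codRestrict _ hmem
  have hkerψ : RingHom.ker (ψ : Polynomial A →+* integralClosure A L)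
      = Ideal.span {(Polynomial.X ^ 2 - Polynomial.C d : Polynomial A)} := by
    apply le_antisymm
    · intro p hp
      apply hker
      exact congrArg Subtype.val hp
    · rw [Ideal.span_singleton_le_iff_mem]
      apply Subtype.ext
      change φ _ = 0
      simp [φ, hww]
  have hsurj : Function.Surjective (ψ : Polynomial A →+* integralClosure A L) := by
    rintro ⟨u, hu⟩
    have hu : IsIntegral A u := hu
    let σ : L →ₐ[A] L :=
      { toFun := star
        map_one' := star_one _
        map_mul' := fun x y => by rw [star_mul, mul_comm]
        map_zero' := star_zero _
        map_add' := star_add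
        commutes' := fun a => by rw [halg]; exact quad_coord2 _ _ }
    have hs : IsIntegral A (star u) := hu.map σ
    have hinjL : Function.Injective (algebraMap K L) := QuadraticAlgebra.algebraMap_injective
    have hK : ∀ x : K, IsIntegral A (algebraMap K L x) → ∃ a, algebraMap A K a = x := fun x hx =>
      IsIntegrallyClosed.isIntegral_iff.mp ((isIntegral_algebraMap_iff hinjL).mp hx)
    obtain ⟨c, hc⟩ : ∃ c, algebraMap A K c = 2 * u.re := by
      apply hK
      have h := hu.add hs
      rwa [← quad_coord3] at h
    obtain ⟨t, ht⟩ := h2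
    have hre : algebraMap A K (↑t⁻¹ * c) = u.re := by
      rw [map_mul, hc, ← mul_assoc]
      have : (2 : K) = algebraMap A K t := by rw [ht]; exact (map_ofNat _ 2).symm
      rw [this, ← map_mul]; simp
    have hwim : IsIntegral A ((u - algebraMap A L (↑t⁻¹ * c)) ^ 2) :=
      (hu.sub isIntegral_algebraMap).pow 2
    obtain ⟨e, he⟩ : ∃ e, algebraMap A K e = u.im ^ 2 * algebraMap A K d := by
      apply hK
      rw [halg, hre] at hwim
      rwa [← quad_coord4] at hwim
    obtain ⟨b, hb⟩ : ∃ b, algebraMap A K b = u.im := by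
      obtain ⟨p, q, hpq, hx⟩ := IsFractionRing.exists_reduced_fraction (A := A) u.im
      have hq0 : algebraMap A K q ≠ 0 := by
        simp
      rw [← hx, IsFractionRing.mk'_eq_div, div_pow, div_mul_eq_mul_div, eq_div_iff (pow_ne_zero 2 hq0)] at he
      simp only [← map_pow, ← map_mul] at he
      have he := hinj he
      have h1 : (q : A) ^ 2 ∣ d := by
        have : IsRelPrime ((q : A) ^ 2) (p ^ 2) := (hpq.symm).pow
        exact this.dvd_of_dvd_mul_left ⟨e, by rw [← he]; ring⟩
      have h3 : IsUnit (q : A) := hd _ (by rwa [← pow_two])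
      obtain ⟨s, hs⟩ := h3
      refine ⟨p * ↑s⁻¹, ?_⟩
      rw [← hx, IsFractionRing.mk'_eq_div, eq_div_iff hq0, ← map_mul, ← hs, mul_assoc]
      simp
    refine ⟨Polynomial.C (↑t⁻¹ * c) + Polynomial.C b * Polynomial.X, ?_⟩
    apply Subtype.ext
    change φ _ = u
    have : φ (Polynomial.C (↑t⁻¹ * c) + Polynomial.C b * Polynomial.X)
      = algebraMap A L (↑t⁻¹ * c) + algebraMap A L b * w := by
      simp only [φ, map_add, map_mul, Polynomial.aeval_C, Polynomial.aeval_X]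
    rw [this, hab, hre, hb]
  have e := (Ideal.quotEquivOfEq hkerψ.symm).trans (RingHom.quotientKerEquivOfSurjective hsurj)
  have : IsIntegrallyClosed (integralClosure A L) :=
    integralClosure.isIntegrallyClosedOfFiniteExtension K
  exact ⟨e.toMulEquiv.isDomain _, IsIntegrallyClosed.of_equiv e.symm⟩

lemma sqfree_aux (k : Type*) [Field k] (h2 : (2 : k) ≠ 0) (m : ℕ) (hm : 1 ≤ m) :
    Squarefree (-(X 0 * X 1 ^ 2 + X 0 ^ (m + 1)) : MvPolynomial (Fin 2) k) := by
  have hY : Prime (X 0 : MvPolynomial (Fin 2) k) := X_prime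
  have h0 : (-(X 0 * X 1 ^ 2 + X 0 ^ (m + 1)) : MvPolynomial (Fin 2) k) ≠ 0 := by
    intro h
    have := congrArg (eval ![1, 0]) h
    simp at this
  rw [squarefree_iff_irreducible_sq_not_dvd_of_ne_zero h0]
  intro q hq hdvd
  have hqp : Prime q := hq.prime
  have hqd : q ∣ -(X 0 * X 1 ^ 2 + X 0 ^ (m + 1)) := (dvd_mul_right q q).trans hdvd
  have h1 : q ∣ 2 * (X 0 * X 1) := by
    obtain ⟨c, hc⟩ := hdvd
    have := congrArg (pderiv 1) hc
    simp [Derivation.leibniz, Derivation.leibniz_pow, pderiv_X] at this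
    rw [← dvd_neg]
    refine ⟨q * pderiv 1 c + c * pderiv 1 q + c * pderiv 1 q, ?_⟩
    linear_combination this
  have h2u : IsUnit (2 : MvPolynomial (Fin 2) k) := by
    have := (Ne.isUnit h2).map (C : k →+* MvPolynomial (Fin 2) k)
    rwa [map_ofNat] at this
  have h3 : q ∣ X 0 * X 1 := (h2u.dvd_mul_left).mp h1
  have h4 : q ∣ X 0 := by
    rcases hqp.dvd_or_dvd h3 with h | h
    · exact h
    · rw [dvd_neg] at hqd
      have : q ∣ X 0 ^ (m + 1) :=
        (dvd_add_right ((dvd_pow h two_ne_zero).mul_left _)).mp hqd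
      exact hqp.dvd_of_dvd_pow this
  have h5 : Associated q (X 0) := hq.associated_of_dvd hY.irreducible h4
  have h6 : (X 0 * X 0 : MvPolynomial (Fin 2) k) ∣ X 0 * (X 1 ^ 2 + X 0 ^ m) := by
    have h := (h5.mul_mul h5).symm.dvd.trans hdvd
    rw [dvd_neg] at h
    convert h using 1; ring
  have h7 := (mul_dvd_mul_iff_left hY.ne_zero).mp h6
  have h8 := map_dvd (eval ![(0 : k), 1]) h7
  simp [show m ≠ 0 by omega] at h8

/-- for `k` algebraically closed of characteristic different from 2 and `n ≥ 4`,
`R₁ = k[X,Y,Z]/(X² + YZ² + Y^(n-1))` is a normal domain of Krull dimension 2. -/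
theorem typeD_singularity_normal_domain_dim_two (k : Type*) [Field k] [IsAlgClosed k]
    (hchar : ringChar k ≠ 2) (n : ℕ) (hn : 4 ≤ n) :
    letI R₁ := MvPolynomial (Fin 3) k ⧸ Ideal.span
      {(X 0 : MvPolynomial (Fin 3) k) ^ 2 + X 1 * (X 2 : MvPolynomial (Fin 3) k) ^ 2
        + (X 1 : MvPolynomial (Fin 3) k) ^ (n - 1)}
    IsDomain R₁ ∧ IsIntegrallyClosed R₁ ∧ ringKrullDim R₁ = 2 := by
  obtain ⟨m, rfl⟩ : ∃ m, n = m + 2 := ⟨n - 2, by omega⟩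
  have h2 : (2 : k) ≠ 0 := Ring.two_ne_zero hchar
  rw [show m + 2 - 1 = m + 1 by omega]
  set f : MvPolynomial (Fin 3) k := X 0 ^ 2 + X 1 * X 2 ^ 2 + X 1 ^ (m + 1) with hf
  set d : MvPolynomial (Fin 2) k := -(X 0 * X 1 ^ 2 + X 0 ^ (m + 1)) with hd
  have h2u : IsUnit (2 : MvPolynomial (Fin 2) k) := by
    have := (Ne.isUnit h2).map (C : k →+* MvPolynomial (Fin 2) k)
    rwa [map_ofNat] at this
  have hdu : ¬ IsUnit d := by
    intro h
    have := h.map (eval ![(0 : k), 0])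
    simp [hd] at this
  obtain ⟨D, N⟩ := quad_normal_aux _ h2u d (sqfree_aux k h2 m (by omega)) hdu
  have hfe : finSuccEquiv k 2 f = Polynomial.X ^ 2 - Polynomial.C d := by
    have e1 : finSuccEquiv k 2 (X 1) = Polynomial.C (X 0) := finSuccEquiv_X_succ (j := 0)
    have e2 : finSuccEquiv k 2 (X 2) = Polynomial.C (X 1) := finSuccEquiv_X_succ (j := 1)
    rw [hf, hd]
    simp only [map_add, map_mul, map_pow, map_neg, e1, e2, finSuccEquiv_X_zero]
    ring
  let e : (MvPolynomial (Fin 3) k ⧸ Ideal.span {f}) ≃+*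
      (Polynomial (MvPolynomial (Fin 2) k) ⧸
        Ideal.span {(Polynomial.X ^ 2 - Polynomial.C d : Polynomial (MvPolynomial (Fin 2) k))}) :=
    Ideal.quotientEquiv (Ideal.span {f})
      (Ideal.span {(Polynomial.X ^ 2 - Polynomial.C d : Polynomial (MvPolynomial (Fin 2) k))})
      (finSuccEquiv k 2).toRingEquiv (by
        rw [Ideal.map_span, Set.image_singleton, ← hfe]; rfl)
  have hD : IsDomain (MvPolynomial (Fin 3) k ⧸ Ideal.span {f}) := e.toMulEquiv.isDomain _
  refine ⟨hD, IsIntegrallyClosed.of_equiv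
    (R := Polynomial (MvPolynomial (Fin 2) k) ⧸
      Ideal.span {(Polynomial.X ^ 2 - Polynomial.C d : Polynomial (MvPolynomial (Fin 2) k))})
    e.symm, ?_⟩
  obtain ⟨i, hi⟩ := IsAlgClosed.exists_pow_nat_eq (-1 : k) (n := 2) (by norm_num)
  have hf0 : f ≠ 0 := by
    intro h
    have := congrArg (eval ![(1 : k), 0, 0]) h
    simp [hf] at this
  apply le_antisymm
  · have h := ringKrullDim_quotient_succ_le_of_nonZeroDivisor (mem_nonZeroDivisors_of_ne_zero hf0)
    rw [MvPolynomial.ringKrullDim_of_isNoetherianRing, ringKrullDim_eq_zero_of_field,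
      Nat.card_eq_fintype_card, Fintype.card_fin, zero_add] at h
    have h' : ringKrullDim (MvPolynomial (Fin 3) k ⧸ Ideal.span {f}) + 1 ≤ 2 + 1 := by
      refine h.trans (le_of_eq ?_); norm_num
    exact ENat.WithBot.add_le_add_one_right_iff.mp h'
  · let g : MvPolynomial (Fin 3) k →ₐ[k] Polynomial k := aeval ![0, 0, Polynomial.X]
    have hg : ∀ a ∈ Ideal.span {f}, g a = 0 := by
      intro a ha
      obtain ⟨c, rfl⟩ := Ideal.mem_span_singleton.mp ha
      simp [g, hf]
    have hgs : Function.Surjective g := by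
      intro p
      refine ⟨Polynomial.aeval (X 2) p, ?_⟩
      rw [← Polynomial.aeval_algHom_apply]
      simp [g]
    have hy : Ideal.Quotient.mk (Ideal.span {f}) (X 1) ≠ 0 := by
      intro h
      rw [Ideal.Quotient.eq_zero_iff_mem, Ideal.mem_span_singleton] at h
      have := map_dvd (eval ![i, 1, 0]) h
      simp [hf, hi] at this
    have h := ringKrullDim_succ_le_of_surjective
      (Ideal.Quotient.lift (Ideal.span {f}) (g : _ →+* Polynomial k) hg)
      (Ideal.Quotient.lift_surjective_of_surjective _ _ hgs)
      (mem_nonZeroDivisors_of_ne_zero hy) (by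
        have h1 : g (X 1) = 0 := by simp [g]
        exact h1)
    rw [Polynomial.ringKrullDim_of_isNoetherianRing, ringKrullDim_eq_zero_of_field] at h
    refine le_trans (le_of_eq ?_) h
    norm_num
end

section
/- Let k be an algebraically closed field of characteristic different from 2, let n ≥ 4, set m = 2n − 4, and let i ∈ k satisfy i² = −1. Let σ be the k-algebra automorphism of k[u, v] determined by σ(u) = i·v and σ(v) = i·u. Let R be the set of polynomials f ∈ k[u,v] such that (1) every monomial u^a v^b occurring in f satisfies a ≡ b (mod m), and (2) σ(f) = f. Then R is a k-subalgebra of k[u,v] and R equals the k-subalgebra generated by the three elements uv·(u^m − (−1)^n v^m), u²v², and u^m + (−1)^n v^m. -/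
open MvPolynomial

/-- Membership of the power sums in the subalgebra. -/
lemma typeD_aux {k A : Type*} [Field k] [CommRing A] [Algebra k A] (S : Subalgebra k A)
    (w U V : A) (h1 : w * (U - V) ∈ S) (h2 : U + V ∈ S) (h3 : U * V ∈ S) (t : ℕ) :
    (U ^ t + V ^ t ∈ S ∧ w * (U ^ t - V ^ t) ∈ S) ∧
    (U ^ (t+1) + V ^ (t+1) ∈ S ∧ w * (U ^ (t+1) - V ^ (t+1)) ∈ S) := by
  induction t with
  | zero =>
    refine ⟨⟨?_, ?_⟩, ?_, ?_⟩
    · simpa using S.add_mem S.one_mem S.one_mem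
    · simp
    · simpa using h2
    · simpa using h1
  | succ t ih =>
    obtain ⟨⟨a, b⟩, c, d⟩ := ih
    refine ⟨⟨c, d⟩, ?_, ?_⟩
    · have := S.sub_mem (S.mul_mem h2 c) (S.mul_mem h3 a)
      convert this using 1; ring
    · have := S.sub_mem (S.mul_mem h2 d) (S.mul_mem h3 b)
      convert this using 1; ring

/-- Symmetrized monomials lie in the subalgebra. -/
lemma typeD_mono {k A : Type*} [Field k] [CommRing A] [Algebra k A] (S : Subalgebra k A)
    (n : ℕ) (hn : 4 ≤ n) (i : k) (hi : i ^ 2 = -1) (u v : A)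
    (h1 : u * v * (u ^ (2*n-4) - (-1 : k) ^ n • v ^ (2*n-4)) ∈ S)
    (h3 : u ^ 2 * v ^ 2 ∈ S)
    (h2 : u ^ (2*n-4) + (-1 : k) ^ n • v ^ (2*n-4) ∈ S) (b t : ℕ) :
    u ^ (b + (2*n-4) * t) * v ^ b +
      i ^ (b + (2*n-4) * t + b) • (u ^ b * v ^ (b + (2*n-4) * t)) ∈ S := by
  obtain ⟨l, rfl⟩ : ∃ l, n = l + 2 := ⟨n - 2, by omega⟩
  have hm : 2 * (l + 2) - 4 = 2 * l := by omega
  rw [hm] at h1 h2 ⊢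
  have hS : (u ^ (2*l)) * ((-1 : k) ^ (l+2) • v ^ (2*l)) ∈ S := by
    have := S.smul_mem (S.pow_mem h3 l) ((-1 : k) ^ (l+2))
    convert this using 1
    rw [mul_smul_comm]; congr 1; ring
  obtain ⟨⟨p, q⟩, -⟩ := typeD_aux S (u * v) _ _ h1 h2 hS t
  have hpow : i ^ (b + 2 * l * t + b) = (-1) ^ b * ((-1) ^ (l+2)) ^ t := by
    rw [show b + 2 * l * t + b = 2 * (b + l * t) by ring, pow_mul, hi, pow_add, pow_mul]
    congr 2; ring
  rw [hpow]
  rcases Nat.even_or_odd' b with ⟨c, rfl | rfl⟩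
  · have := S.mul_mem (S.pow_mem h3 c) p
    convert this using 1
    simp only [Algebra.smul_def, map_mul, map_pow, map_neg, map_one]
    rw [pow_mul (-1 : A) 2 c]
    ring
  · have := S.mul_mem (S.pow_mem h3 c) q
    convert this using 1
    simp only [Algebra.smul_def, map_mul, map_pow, map_neg, map_one]
    rw [pow_succ (-1 : A) (2 * c), pow_mul (-1 : A) 2 c]
    ring

lemma typeD_homog {k : Type*} [Field k] (m : ℕ) (f : MvPolynomial (Fin 2) k) :
    (∀ d ∈ f.support, d 0 ≡ d 1 [MOD m]) ↔
      IsWeightedHomogeneous (![1, -1] : Fin 2 → ZMod m) f 0 := by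
  have key : ∀ d : Fin 2 →₀ ℕ, Finsupp.weight (![1, -1] : Fin 2 → ZMod m) d = 0 ↔
      d 0 ≡ d 1 [MOD m] := by
    intro d
    rw [← ZMod.natCast_eq_natCast_iff, Finsupp.weight_apply, Finsupp.sum_fintype _ _ (by simp)]
    simp [← sub_eq_add_neg, sub_eq_zero]
  constructor
  · intro h d hd
    exact (key d).2 (h d (mem_support_iff.2 hd))
  · intro h d hd
    exact (key d).1 (h (mem_support_iff.1 hd))


/-- for `k` algebraically closed with `char k ≠ 2`, `n ≥ 4`, `m = 2n - 4`,
`i² = -1`, and `σ` the `k`-algebra endomorphism of `k[u,v]` with `σ(u) = iv`, `σ(v) = iu`,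
the set of polynomials `f` all of whose monomials `uᵃvᵇ` satisfy `a ≡ b (mod m)` and with
`σ(f) = f` is exactly the `k`-subalgebra generated by `uv(uᵐ - (-1)ⁿ vᵐ)`, `u²v²` and
`uᵐ + (-1)ⁿ vᵐ`; in particular it is a `k`-subalgebra of `k[u,v]`. -/
theorem typeD_invariants_eq_adjoin (k : Type*) [Field k] [IsAlgClosed k]
    (hchar : ringChar k ≠ 2) (n : ℕ) (hn : 4 ≤ n) (i : k) (hi : i ^ 2 = -1) :
    letI m := 2 * n - 4
    letI u : MvPolynomial (Fin 2) k := X 0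
    letI v : MvPolynomial (Fin 2) k := X 1
    letI σ : MvPolynomial (Fin 2) k →ₐ[k] MvPolynomial (Fin 2) k :=
      aeval ![C i * v, C i * u]
    {f : MvPolynomial (Fin 2) k |
        (∀ d ∈ f.support, d 0 ≡ d 1 [MOD m]) ∧ σ f = f}
      = (Algebra.adjoin k
          {u * v * (u ^ m - (-1 : k) ^ n • v ^ m), u ^ 2 * v ^ 2,
           u ^ m + (-1 : k) ^ n • v ^ m} : Subalgebra k (MvPolynomial (Fin 2) k)) := by

  have h2 : (2 : k) ≠ 0 := Ring.two_ne_zero hchar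
  obtain ⟨l, hl⟩ : ∃ l, n = l + 2 := ⟨n - 2, by omega⟩
  have hm : 2 * n - 4 = 2 * l := by omega
  have hpm : i ^ (2 * n - 4) = (-1) ^ n := by
    rw [hm, pow_mul, hi, hl, pow_add]; simp
  have hC2 : (C i : MvPolynomial (Fin 2) k) ^ 2 = -1 := by
    rw [← map_pow, hi]; simp
  have hCm : (C i : MvPolynomial (Fin 2) k) ^ (2 * n - 4) = (-1) ^ n := by
    rw [← map_pow, hpm]; simp
  have hsq : ((-1 : MvPolynomial (Fin 2) k) ^ n) * (-1) ^ n = 1 := by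
    rw [← mul_pow]; simp
  have hX : ∀ j : Fin 2, IsWeightedHomogeneous (![1, -1] : Fin 2 → ZMod (2 * n - 4))
      (X j : MvPolynomial (Fin 2) k) (![1, -1] j : ZMod (2 * n - 4)) :=
    fun j => isWeightedHomogeneous_X k _ j
  have hm0 : ((2 * n - 4 : ℕ) : ZMod (2 * n - 4)) = 0 := ZMod.natCast_self _
  have hXm : ∀ j : Fin 2, IsWeightedHomogeneous (![1, -1] : Fin 2 → ZMod (2 * n - 4))
      (X j ^ (2 * n - 4) : MvPolynomial (Fin 2) k) 0 := by
    intro j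
    have := (hX j).pow (2 * n - 4)
    rwa [nsmul_eq_mul, hm0, zero_mul] at this
  have h01 : IsWeightedHomogeneous (![1, -1] : Fin 2 → ZMod (2 * n - 4))
      (X 0 * X 1 : MvPolynomial (Fin 2) k) 0 := by
    simpa using (hX 0).mul (hX 1)
  have hsm : ∀ (c : k) (f : MvPolynomial (Fin 2) k),
      IsWeightedHomogeneous (![1, -1] : Fin 2 → ZMod (2 * n - 4)) f 0 →
      IsWeightedHomogeneous (![1, -1] : Fin 2 → ZMod (2 * n - 4)) (c • f) 0 :=
    fun c f hf => (weightedHomogeneousSubmodule k _ _).smul_mem c hf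
  apply Set.Subset.antisymm
  · rintro f ⟨hf, hσ⟩
    set S := Algebra.adjoin k
          {X 0 * X 1 * (X 0 ^ (2 * n - 4) - (-1 : k) ^ n • X 1 ^ (2 * n - 4)), X 0 ^ 2 * X 1 ^ 2,
           (X 0 ^ (2 * n - 4) + (-1 : k) ^ n • X 1 ^ (2 * n - 4) : MvPolynomial (Fin 2) k)} with hS
    have g1 : X 0 * X 1 * (X 0 ^ (2 * n - 4) - (-1 : k) ^ n • X 1 ^ (2 * n - 4)) ∈ S :=
      Algebra.subset_adjoin (by simp)
    have g2 : (X 0 ^ 2 * X 1 ^ 2 : MvPolynomial (Fin 2) k) ∈ S :=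
      Algebra.subset_adjoin (by simp)
    have g3 : X 0 ^ (2 * n - 4) + (-1 : k) ^ n • X 1 ^ (2 * n - 4) ∈ S :=
      Algebra.subset_adjoin (by simp)
    have main := typeD_mono S n hn i hi (X 0) (X 1) g1 g2 g3
    change f ∈ S
    have hmono : ∀ d : Fin 2 →₀ ℕ, ∀ c : k, d 0 ≡ d 1 [MOD (2 * n - 4)] →
        monomial d c + aeval ![C i * X 1, C i * X 0] (monomial d c) ∈ S := by
      intro d c hd
      have e1 : monomial d c = c • (X 0 ^ d 0 * X 1 ^ d 1 : MvPolynomial (Fin 2) k) := by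
        rw [monomial_eq, Finsupp.prod_fintype _ _ (by simp), smul_eq_C_mul]
        simp
      have e2 : monomial d c + aeval ![C i * X 1, C i * X 0] (monomial d c) =
          c • (X 0 ^ d 0 * X 1 ^ d 1 + i ^ (d 0 + d 1) • (X 0 ^ d 1 * X 1 ^ d 0) :
            MvPolynomial (Fin 2) k) := by
        rw [e1]
        simp only [map_mul, map_pow, aeval_X, aeval_C, algebraMap_eq, smul_eq_C_mul, Matrix.cons_val_zero,
          Matrix.cons_val_one]
        ring
      rw [e2]
      refine S.smul_mem ?_ c
      rcases le_total (d 1) (d 0) with h | h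
      · obtain ⟨t, ht⟩ := (Nat.modEq_iff_dvd' h).1 hd.symm
        have h0 : d 0 = d 1 + (2 * n - 4) * t := by omega
        rw [h0]
        exact main (d 1) t
      · obtain ⟨t, ht⟩ := (Nat.modEq_iff_dvd' h).1 hd
        have h0 : d 1 = d 0 + (2 * n - 4) * t := by omega
        rw [h0]
        have := S.smul_mem (main (d 0) t) (i ^ (d 0 + (2 * n - 4) * t + d 0))
        convert this using 1
        rw [smul_add, smul_smul]
        have : i ^ (d 0 + (2 * n - 4) * t + d 0) * i ^ (d 0 + (2 * n - 4) * t + d 0) = 1 := by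
          rw [← mul_pow, ← sq, hi, hm]
          exact Even.neg_one_pow ⟨d 0 + l * t, by ring⟩
        rw [this, one_smul, add_comm]
        congr 2
        ring
    have hsum : f + aeval ![C i * X 1, C i * X 0] f ∈ S := by
      have : f + aeval ![C i * X 1, C i * X 0] f = ∑ d ∈ f.support,
          (monomial d (coeff d f) + aeval ![C i * X 1, C i * X 0] (monomial d (coeff d f))) := by
        rw [Finset.sum_add_distrib, ← map_sum, ← f.as_sum]
      rw [this]
      exact S.sum_mem fun d hd => hmono d _ (hf d hd)
    rw [hσ] at hsum
    have := S.smul_mem hsum (2⁻¹ : k)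
    rwa [← two_smul k f, smul_smul, inv_mul_cancel₀ h2, one_smul] at this
  · intro f hf
    simp only [Set.mem_ofPred_eq, typeD_homog]
    change f ∈ Algebra.adjoin k _ at hf
    induction hf using Algebra.adjoin_induction with
    | mem x hx =>
      rcases hx with rfl | rfl | rfl
      · refine ⟨?_, ?_⟩
        · have := h01.mul ((weightedHomogeneousSubmodule k _ _).sub_mem (hXm 0)
            (hsm ((-1) ^ n) _ (hXm 1)))
          rwa [add_zero] at this
        · simp only [map_mul, map_pow, map_sub, aeval_X, smul_eq_C_mul,
            Matrix.cons_val_zero, Matrix.cons_val_one, mul_pow, hCm, map_neg, map_one]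
          linear_combination (X 1 * X 0 * ((-1)^n * X 1 ^ (2*n-4) - X 0 ^ (2*n-4))) * hC2 -
            C i ^ 2 * X 1 * X 0 * X 0 ^ (2*n-4) * hsq
      · refine ⟨?_, ?_⟩
        · have := h01.mul h01
          rw [add_zero] at this
          convert this using 1
          ring
        · simp only [map_mul, map_pow, aeval_X, Matrix.cons_val_zero, Matrix.cons_val_one,
            mul_pow, hC2]
          ring
      · refine ⟨(hXm 0).add (hsm ((-1) ^ n) _ (hXm 1)), ?_⟩
        simp only [map_mul, map_add, map_pow, aeval_X, smul_eq_C_mul,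
            Matrix.cons_val_zero, Matrix.cons_val_one, mul_pow, hCm, map_neg, map_one]
        linear_combination X 0 ^ (2*n-4) * hsq
    | algebraMap r =>
      exact ⟨isWeightedHomogeneous_C _ r, by simp [algebraMap_eq]⟩
    | add x y _ _ hx hy => exact ⟨hx.1.add hy.1, by rw [map_add, hx.2, hy.2]⟩
    | mul x y _ _ hx hy =>
      exact ⟨by simpa using hx.1.mul hy.1, by rw [map_mul, hx.2, hy.2]⟩
end
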